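/- Let n ≥ 2, δ, ε ∈ (0,1), r > 0, set U_ε = B_1 \ closure(B_{1−ε}) ⊂ ℝ^{2n}, and let φ be a symplectic embedding of an open neighborhood of rA_δ into U_ε. If the bounded connected component of ℝ^{2n} \ φ(S_{r(1−δ)}^{2n−1}) contains closure(B_{1−ε}), then 1 − ε < r(1−δ) and r < 1; in particular δ < ε. -/

import Mathlib

open Metric Set MeasureTheory Real Filter Topology Bornology
open scoped ContDiff ENNReal

noncomputable section

/-- `ℝ^{2n}` with the Euclidean structure. -/
abbrev R2n (n : ℕ) := EuclideanSpace ℝ (Fin (2 * n))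

/-- The standard symplectic form `ω_st = Σ dx_i ∧ dy_i` on `ℝ^{2n}`,
evaluated on a pair of (tangent) vectors. -/
def sympForm (n : ℕ) (v w : R2n n) : ℝ :=
  ∑ i : Fin n,
    (v ⟨2 * i.1, by have := i.isLt; omega⟩ * w ⟨2 * i.1 + 1, by have := i.isLt; omega⟩ -
      v ⟨2 * i.1 + 1, by have := i.isLt; omega⟩ * w ⟨2 * i.1, by have := i.isLt; omega⟩)

/-- `φ` is a symplectic embedding of the open set `N ⊆ ℝ^{2n}` into `U ⊆ ℝ^{2n}`:
a smooth injective map on `N` with image in `U` whose derivative preserves `ω_st`. -/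
def IsSympEmbOn (n : ℕ) (N U : Set (R2n n)) (φ : R2n n → R2n n) : Prop :=
  IsOpen N ∧ ContDiffOn ℝ ∞ φ N ∧ InjOn φ N ∧ MapsTo φ N U ∧
    ∀ p ∈ N, ∀ v w : R2n n,
      sympForm n (fderiv ℝ φ p v) (fderiv ℝ φ p w) = sympForm n v w

/-- A symplectic embedding of (a neighbourhood of) an arbitrary set `A ⊆ ℝ^{2n}` into `U`. -/
def SympEmbNbhd (n : ℕ) (A U : Set (R2n n)) : Prop :=
  ∃ N φ, A ⊆ N ∧ IsSympEmbOn n N U φ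

/-- The spherical capacity `s(U)`. -/
def sphericalCap (n : ℕ) (U : Set (R2n n)) : ℝ≥0∞ :=
  sSup {c : ℝ≥0∞ | ∃ r : ℝ, 0 < r ∧ c = ENNReal.ofReal (π * r ^ 2) ∧
    SympEmbNbhd n (sphere (0 : R2n n) r) U}

/-- The quadratic form defining the ellipsoid with symplectic half axes `a i`. -/
def ellQ (n : ℕ) (a : Fin n → ℝ) (z : R2n n) : ℝ :=
  ∑ i : Fin n,
    ((z ⟨2 * i.1, by have := i.isLt; omega⟩) ^ 2 +
      (z ⟨2 * i.1 + 1, by have := i.isLt; omega⟩) ^ 2) / (a i) ^ 2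

/-- The open ellipsoid `E(a 0, …, a (n-1)) ⊆ ℝ^{2n}`. -/
def ellipsoid (n : ℕ) (a : Fin n → ℝ) : Set (R2n n) := {z | ellQ n a z < 1}

/-- The boundary `∂E(a 0, …, a (n-1)) ⊆ ℝ^{2n}` of an ellipsoid. -/
def ellipsoidBdry (n : ℕ) (a : Fin n → ℝ) : Set (R2n n) := {z | ellQ n a z = 1}

/-- The ellipsoidal shell `U_ε = (1+ε)E \ closure((1-ε)E)`. -/
def ellShell (n : ℕ) (a : Fin n → ℝ) (ε : ℝ) : Set (R2n n) :=
  ellipsoid n (fun i => (1 + ε) * a i) \ closure (ellipsoid n (fun i => (1 - ε) * a i))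

/-- The `δ`-shell capacity `c_δ(U)`, defined via embeddings of the closed
shells `r A_δ = closure(B_r) \ B_{r(1-δ)}`. -/
def shellCap (n : ℕ) (δ : ℝ) (U : Set (R2n n)) : ℝ≥0∞ :=
  sSup {c : ℝ≥0∞ | ∃ r : ℝ, 0 < r ∧ c = ENNReal.ofReal (π * r ^ 2) ∧
    SympEmbNbhd n (closedBall (0 : R2n n) r \ ball 0 (r * (1 - δ))) U}

/-- The ellipsoidal capacity `e(U)`: the supremum of `π r₁²` over symplectic embeddings of
boundaries of ellipsoids with half axes `r₁ ≤ … ≤ r_n` (here `r₁ = ⨅ i, a i`). -/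
def ellipsoidalCap (n : ℕ) (U : Set (R2n n)) : ℝ≥0∞ :=
  sSup {c : ℝ≥0∞ | ∃ a : Fin n → ℝ, (∀ i, 0 < a i) ∧ Monotone a ∧
    c = ENNReal.ofReal (π * (⨅ i, a i) ^ 2) ∧ SympEmbNbhd n (ellipsoidBdry n a) U}

/-- The Gromov radius `c_B(U)`. -/
def gromovRadius (n : ℕ) (U : Set (R2n n)) : ℝ≥0∞ :=
  sSup {c : ℝ≥0∞ | ∃ r : ℝ, 0 < r ∧ c = ENNReal.ofReal (π * r ^ 2) ∧
    ∃ φ, IsSympEmbOn n (ball (0 : R2n n) r) U φ}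

section ColumnDeterminant

variable {ι : Type*} [Fintype ι] [DecidableEq ι]

/-- The `i`-th standard basis vector. -/
abbrev stdVec (i : ι) : EuclideanSpace ℝ ι := EuclideanSpace.basisFun ι ℝ i

/-- The determinant of a family of vectors, as a continuous multilinear map. -/
def colDet (ι : Type*) [Fintype ι] [DecidableEq ι] :
    ContinuousMultilinearMap ℝ (fun _ : ι => EuclideanSpace ℝ ι) ℝ where
  toMultilinearMap := (EuclideanSpace.basisFun ι ℝ).toBasis.det.toMultilinearMap
  cont := by
    change Continuous fun v : ι → EuclideanSpace ℝ ι =>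
      (EuclideanSpace.basisFun ι ℝ).toBasis.det v
    simp only [Module.Basis.det_apply]
    refine Continuous.matrix_det (continuous_matrix fun i j => ?_)
    simp only [Module.Basis.toMatrix_apply, OrthonormalBasis.coe_toBasis_repr_apply,
      EuclideanSpace.basisFun_repr]
    fun_prop

theorem colDet_eq_det (v : ι → EuclideanSpace ℝ ι) :
    colDet ι v = (EuclideanSpace.basisFun ι ℝ).toBasis.det v := rfl

theorem colDet_map (L : EuclideanSpace ℝ ι →L[ℝ] EuclideanSpace ℝ ι) :
    colDet ι (fun i => L (stdVec i)) = L.det := by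
  have h := (EuclideanSpace.basisFun ι ℝ).toBasis.det_comp (L : _ →ₗ[ℝ] _)
    (EuclideanSpace.basisFun ι ℝ).toBasis
  rw [Module.Basis.det_self, mul_one] at h
  rw [colDet_eq_det, ContinuousLinearMap.det, ← h]
  congr 1

theorem colDet_update_update_swap (V : ι → EuclideanSpace ℝ ι) {j k : ι} (hjk : j ≠ k)
    (a w : EuclideanSpace ℝ ι) :
    colDet ι (Function.update (Function.update V j a) k w) =
      -colDet ι (Function.update (Function.update V k a) j w) := by
  rw [colDet_eq_det, colDet_eq_det, ← AlternatingMap.map_swap _ _ hjk]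
  congr 1
  ext1 i
  by_cases hij : i = j
  · subst hij
    simp [hjk, hjk.symm]
  · by_cases hik : i = k
    · subst hik
      simp
    · simp [hij, hik, Equiv.swap_apply_of_ne_of_ne hij hik]

/-- Cramer's rule. -/
theorem sum_colDet_update_smul (V : ι → EuclideanSpace ℝ ι) (w : EuclideanSpace ℝ ι) :
    ∑ j, colDet ι (Function.update V j w) • V j = colDet ι V • w := by
  have h := Matrix.mulVec_cramer ((EuclideanSpace.basisFun ι ℝ).toBasis.toMatrix V)
    ((EuclideanSpace.basisFun ι ℝ).toBasis.repr w)
  ext i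
  have hi := congrFun h i
  simp only [Matrix.mulVec, dotProduct, Matrix.cramer_apply, ← Module.Basis.toMatrix_update,
    Pi.smul_apply] at hi
  simp only [PiLp.smul_apply, WithLp.ofLp_sum, Finset.sum_apply, colDet_eq_det,
    Module.Basis.det_apply]
  simp only [smul_eq_mul] at hi ⊢
  convert hi using 1
  · refine Finset.sum_congr rfl fun j _ => ?_
    rw [mul_comm]
    simp [Module.Basis.toMatrix_apply]
  · simp

/-- The Piola identity: the divergence of `adj (Dψ) v` only involves derivatives of `v`. -/
theorem sum_fderiv_colDet_update {ψ v : EuclideanSpace ℝ ι → EuclideanSpace ℝ ι}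
    (hψ : ContDiff ℝ ∞ ψ) (hv : ContDiff ℝ ∞ v) (x : EuclideanSpace ℝ ι) :
    ∑ j, fderiv ℝ (fun y => colDet ι
        (Function.update (fun k => fderiv ℝ ψ y (stdVec k)) j (v y))) x (stdVec j) =
      ∑ j, colDet ι (Function.update (fun k => fderiv ℝ ψ x (stdVec k)) j
        (fderiv ℝ v x (stdVec j))) := by
  set V : ι → EuclideanSpace ℝ ι := fun k => fderiv ℝ ψ x (stdVec k) with hV
  have hψ' : DifferentiableAt ℝ (fderiv ℝ ψ) x :=
    ((hψ.fderiv_right (m := ∞) (by simp)).differentiable (by simp)) x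
  have hd : ∀ j k : ι, HasFDerivAt
      (fun y => Function.update (fun k => fderiv ℝ ψ y (stdVec k)) j (v y) k)
      (if k = j then fderiv ℝ v x else (fderiv ℝ (fderiv ℝ ψ) x).flip (stdVec k)) x := by
    intro j k
    by_cases hk : k = j
    · subst hk
      simpa using ((hv.differentiable (by simp)) x).hasFDerivAt
    · simp only [Function.update_of_ne hk, hk, if_false]
      have := (hψ'.hasFDerivAt).clm_apply (hasFDerivAt_const (stdVec k) x)
      simpa using this
  have key : ∀ j, fderiv ℝ (fun y => colDet ι
        (Function.update (fun k => fderiv ℝ ψ y (stdVec k)) j (v y))) x (stdVec j) =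
      colDet ι (Function.update V j (fderiv ℝ v x (stdVec j))) +
      ∑ k, if k = j then 0 else colDet ι (Function.update (Function.update V j (v x)) k
        (fderiv ℝ (fderiv ℝ ψ) x (stdVec j) (stdVec k))) := by
    intro j
    rw [(HasFDerivAt.multilinear_comp (colDet ι) (hd j)).fderiv]
    rw [← Finset.add_sum_erase _ _ (Finset.mem_univ j),
      ← Finset.add_sum_erase _ (fun k => if k = j then _ else _) (Finset.mem_univ j)]
    simp only [if_true, zero_add, add_apply, ContinuousLinearMap.comp_apply]
    congr 1
    · simp [ContinuousMultilinearMap.toContinuousLinearMap, hV]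
    · rw [_root_.sum_apply]
      refine Finset.sum_congr rfl fun k hk => ?_
      have hkj := Finset.ne_of_mem_erase hk
      simp [ContinuousMultilinearMap.toContinuousLinearMap, hV, hkj]
  simp only [key, Finset.sum_add_distrib]
  rw [add_eq_left]
  have hsymm : ∀ j k, fderiv ℝ (fderiv ℝ ψ) x (stdVec j) (stdVec k) =
      fderiv ℝ (fderiv ℝ ψ) x (stdVec k) (stdVec j) := fun j k =>
    ((hψ.contDiffAt).isSymmSndFDerivAt (by simpa using WithTop.coe_le_coe.2 (le_top : (2 : ℕ∞) ≤ ⊤))) _ _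
  have hanti : ∑ j, ∑ k, (if k = j then 0 else colDet ι
        (Function.update (Function.update V j (v x)) k
        (fderiv ℝ (fderiv ℝ ψ) x (stdVec j) (stdVec k)))) =
      -∑ j, ∑ k, (if k = j then 0 else colDet ι
        (Function.update (Function.update V j (v x)) k
        (fderiv ℝ (fderiv ℝ ψ) x (stdVec j) (stdVec k)))) := by
    conv_rhs => rw [Finset.sum_comm]
    simp only [← Finset.sum_neg_distrib]
    refine Finset.sum_congr rfl fun j _ => Finset.sum_congr rfl fun k _ => ?_
    by_cases hkj : k = j
    · simp [hkj]
    · rw [if_neg hkj, if_neg (Ne.symm hkj), colDet_update_update_swap _ (Ne.symm hkj),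
        hsymm j k]
  linarith

theorem integral_fderiv_apply_eq_zero {κ : Type*} [Fintype κ]
    {u : EuclideanSpace ℝ κ → ℝ} (hu : ContDiff ℝ 1 u)
    (hc : HasCompactSupport u) (a : EuclideanSpace ℝ κ) : ∫ x, fderiv ℝ u x a = 0 := by
  have hcont : Continuous fun x => fderiv ℝ u x a :=
    (hu.continuous_fderiv (by simp)).clm_apply continuous_const
  have hcs : HasCompactSupport fun x => fderiv ℝ u x a := hc.fderiv_apply (𝕜 := ℝ) a
  have h := integral_mul_fderiv_eq_neg_fderiv_mul_of_integrable (μ := volume)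
    (f := fun _ : EuclideanSpace ℝ κ => (1 : ℝ)) (g := u) (v := a) (by simp)
    (by simpa using hcont.integrable_of_hasCompactSupport hcs)
    (by simpa using hu.continuous.integrable_of_hasCompactSupport hc)
    (fun x _ => differentiableAt_const _) (fun x _ => hu.differentiable (by simp) x)
  simpa using h

theorem integral_sum_colDet_update_eq_zero {ψ v : EuclideanSpace ℝ ι → EuclideanSpace ℝ ι}
    (hψ : ContDiff ℝ ∞ ψ) (hv : ContDiff ℝ ∞ v) (hc : HasCompactSupport v) :
    ∫ x, ∑ j, colDet ι (Function.update (fun k => fderiv ℝ ψ x (stdVec k)) j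
        (fderiv ℝ v x (stdVec j))) = 0 := by
  simp only [← sum_fderiv_colDet_update hψ hv]
  have hX : ∀ j, ContDiff ℝ 1 (fun y => colDet ι
        (Function.update (fun k => fderiv ℝ ψ y (stdVec k)) j (v y))) := by
    intro j
    refine (ContinuousMultilinearMap.contDiff _).comp (contDiff_pi.2 fun k => ?_)
    by_cases hk : k = j
    · subst hk
      simpa using hv.of_le (mod_cast le_top)
    · simp only [Function.update_of_ne hk]
      exact ((hψ.fderiv_right (m := 1) (WithTop.coe_le_coe.2 (le_top : (1 + 1 : ℕ∞) ≤ ⊤))).clm_apply contDiff_const)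
  have hXc : ∀ j, HasCompactSupport (fun y => colDet ι
        (Function.update (fun k => fderiv ℝ ψ y (stdVec k)) j (v y))) := by
    intro j
    refine hc.mono fun y hy => ?_
    contrapose! hy
    simp only [Function.mem_support, not_not] at hy ⊢
    exact (colDet ι).map_coord_zero j (by simp [hy])
  rw [integral_finsetSum _ fun j _ => ?_]
  · exact Finset.sum_eq_zero fun j _ => integral_fderiv_apply_eq_zero (hX j) (hXc j) _
  · exact (((hX j).continuous_fderiv (by simp)).clm_apply
      continuous_const).integrable_of_hasCompactSupport ((hXc j).fderiv_apply (𝕜 := ℝ) _)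

end ColumnDeterminant

section LocalValue

variable {ι : Type*} [Fintype ι]

/-- `g` is almost everywhere equal to the constant `c` near `y`. -/
def HasLocalValue (g : EuclideanSpace ℝ ι → ℝ) (y : EuclideanSpace ℝ ι) (c : ℝ) : Prop :=
  ∃ u, IsOpen u ∧ y ∈ u ∧ ∀ᵐ z, z ∈ u → g z = c

theorem HasLocalValue.unique {g : EuclideanSpace ℝ ι → ℝ} {y : EuclideanSpace ℝ ι} {c c' : ℝ}
    (h : HasLocalValue g y c) (h' : HasLocalValue g y c') : c = c' := by
  obtain ⟨u, hu, hyu, hgu⟩ := h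
  obtain ⟨v, hv, hyv, hgv⟩ := h'
  by_contra hne
  have h0 : volume (u ∩ v) = 0 := by
    rw [measure_eq_zero_iff_ae_notMem]
    filter_upwards [hgu, hgv] with z hz hz' hzuv
    exact hne ((hz hzuv.1).symm.trans (hz' hzuv.2))
  exact ((hu.inter hv).measure_pos volume ⟨y, hyu, hyv⟩).ne' h0

theorem HasLocalValue.of_isPreconnected {g : EuclideanSpace ℝ ι → ℝ}
    {U : Set (EuclideanSpace ℝ ι)} (hU : IsPreconnected U)
    (h : ∀ y ∈ U, ∃ c, HasLocalValue g y c) {y y' : EuclideanSpace ℝ ι} (hy : y ∈ U)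
    (hy' : y' ∈ U) {c : ℝ} (hc : HasLocalValue g y c) : HasLocalValue g y' c := by
  have hopen : ∀ S : Set ℝ, IsOpen {z | ∃ c ∈ S, HasLocalValue g z c} := by
    intro S
    refine isOpen_iff_mem_nhds.2 ?_
    rintro z ⟨d, hd, u, hu, hzu, hgu⟩
    filter_upwards [hu.mem_nhds hzu] with w hw
    exact ⟨d, hd, u, hu, hw, hgu⟩
  by_contra hcon
  obtain ⟨z, -, ⟨d, hd, hzd⟩, ⟨d', hd', hzd'⟩⟩ := hU _ _ (hopen {c}) (hopen {c}ᶜ)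
    (fun z hz => by
      obtain ⟨d, hd⟩ := h z hz
      by_cases hdc : d = c
      · exact Or.inl ⟨d, hdc, hd⟩
      · exact Or.inr ⟨d, hdc, hd⟩)
    ⟨y, hy, c, rfl, hc⟩
    (by
      obtain ⟨d, hd⟩ := h y' hy'
      refine ⟨y', hy', d, fun hdc => hcon ?_, hd⟩
      exact (show d = c from hdc) ▸ hd)
  exact hd' ((hzd'.unique hzd).trans hd)

theorem ae_eq_of_forall_hasLocalValue {g : EuclideanSpace ℝ ι → ℝ}
    {U : Set (EuclideanSpace ℝ ι)} {c : ℝ} (h : ∀ y ∈ U, HasLocalValue g y c) :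
    ∀ᵐ z, z ∈ U → g z = c := by
  rw [ae_iff]
  refine measure_null_of_locally_null _ fun y hy => ?_
  simp only [Classical.not_imp, mem_ofPred_eq] at hy
  obtain ⟨u, hu, hyu, hgu⟩ := h y hy.1
  refine ⟨_, inter_mem_nhdsWithin _ (hu.mem_nhds hyu), measure_mono_null ?_ (ae_iff.1 hgu)⟩
  rintro z ⟨hz, hzu⟩
  simp only [Classical.not_imp, mem_ofPred_eq] at hz ⊢
  exact ⟨hzu, hz.2⟩

/-- A locally integrable function with vanishing weak derivative near `y` is almost everywhere
constant near `y`. -/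
theorem exists_hasLocalValue_of_weak_fderiv_eq_zero {g : EuclideanSpace ℝ ι → ℝ}
    (hg : LocallyIntegrable g volume) {y : EuclideanSpace ℝ ι} {η : ℝ} (hη : 0 < η)
    (h : ∀ f : EuclideanSpace ℝ ι → ℝ, ContDiff ℝ ∞ f → HasCompactSupport f →
      tsupport f ⊆ ball y (2 * η) → ∀ a, ∫ z, g z * fderiv ℝ f z a = 0) :
    ∃ c, HasLocalValue g y c := by
  let φ : ℕ → ContDiffBump (0 : EuclideanSpace ℝ ι) := fun k =>
    ⟨η / 4 / (k + 1), η / 2 / (k + 1), by positivity, by gcongr; linarith⟩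
  have hout : ∀ k, (φ k).rOut = η / 2 / (k + 1) := fun k => rfl
  have hlt : ∀ k, (φ k).rOut < η := fun k => by
    rw [hout]
    refine (div_le_self (by positivity) ?_).trans_lt (by linarith)
    linarith [(Nat.cast_nonneg k : (0 : ℝ) ≤ k)]
  have hlim : Tendsto (fun k => (φ k).rOut) atTop (𝓝 0) := by
    simp only [hout]
    exact tendsto_const_nhds.div_atTop
      (tendsto_atTop_add_const_right _ _ tendsto_natCast_atTop_atTop)
  have hae := ContDiffBump.ae_convolution_tendsto_right_of_locallyIntegrable (φ := φ) (K := 2)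
    hlim (Eventually.of_forall fun k => by
      change η / 2 / (k + 1 : ℝ) ≤ 2 * (η / 4 / (k + 1))
      apply le_of_eq; ring) hg
  have hder : ∀ k, ∀ x ∈ ball y η, HasFDerivAt
      (MeasureTheory.convolution ((φ k).normed volume) g (ContinuousLinearMap.lsmul ℝ ℝ) volume)
      (0 : EuclideanSpace ℝ ι →L[ℝ] ℝ) x := by
    intro k x hx
    have hsm : ContDiff ℝ ∞ ((φ k).normed volume) := (φ k).contDiff_normed
    have hcs : HasCompactSupport ((φ k).normed volume) := (φ k).hasCompactSupport_normed
    have h1 := hcs.hasFDerivAt_convolution_left (ContinuousLinearMap.lsmul ℝ ℝ)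
      (hsm.of_le (mod_cast le_top)) hg x
    suffices hz : MeasureTheory.convolution (fderiv ℝ ((φ k).normed volume)) g
        ((ContinuousLinearMap.lsmul ℝ ℝ).precompL (EuclideanSpace ℝ ι)) volume x = 0 by
      rwa [hz] at h1
    refine ContinuousLinearMap.ext fun a => ?_
    rw [MeasureTheory.convolution_eq_swap, ContinuousLinearMap.integral_apply]
    · have h2 := h (fun z => (φ k).normed volume (x - z)) (hsm.comp (by fun_prop))
        (hcs.comp_homeomorph (Homeomorph.subLeft x)) (by
          refine (closure_mono ?_).trans ((isClosed_closedBall (x := x)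
            (ε := (φ k).rOut)).closure_subset.trans ?_)
          · intro z hz
            have : x - z ∈ Function.support ((φ k).normed volume) := hz
            rw [(φ k).support_normed_eq] at this
            rw [mem_closedBall, dist_comm, dist_eq_norm]
            exact (mem_ball_zero_iff.1 this).le
          · refine closedBall_subset_ball' ?_
            linarith [hlt k, mem_ball.1 hx]) a
      rw [_root_.zero_apply]
      refine Eq.trans ?_ (neg_eq_zero.2 h2)
      rw [← integral_neg]
      refine integral_congr_ae (Eventually.of_forall fun z => ?_)
      have h3 : HasFDerivAt (fun z => (φ k).normed volume (x - z))
          ((fderiv ℝ ((φ k).normed volume) (x - z)).comp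
            (-ContinuousLinearMap.id ℝ (EuclideanSpace ℝ ι))) z :=
        ((hsm.differentiable (by simp)) (x - z)).hasFDerivAt.comp z
          ((hasFDerivAt_id z).const_sub x)
      simp [h3.fderiv, ContinuousLinearMap.precompL_apply, mul_comm]
    · have := (hcs.fderiv (𝕜 := ℝ)).convolutionExists_left
        ((ContinuousLinearMap.lsmul ℝ ℝ).precompL (EuclideanSpace ℝ ι))
        (hsm.continuous_fderiv (by simp)) hg x
      exact this.integrable_swap
  have hconst : ∀ k, ∃ c, ∀ x ∈ ball y η, MeasureTheory.convolution ((φ k).normed volume) g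
      (ContinuousLinearMap.lsmul ℝ ℝ) volume x = c := fun k =>
    isOpen_ball.exists_is_const_of_fderiv_eq_zero (convex_ball y η).isPreconnected
      (fun x hx => (hder k x hx).differentiableAt.differentiableWithinAt)
      (fun x hx => (hder k x hx).fderiv)
  choose c hc using hconst
  obtain ⟨x₀, hx₀, hx₀lim⟩ : ∃ x₀ ∈ ball y η, Tendsto (fun k => MeasureTheory.convolution
      ((φ k).normed volume) g (ContinuousLinearMap.lsmul ℝ ℝ) volume x₀) atTop (𝓝 (g x₀)) := by
    by_contra! hcon
    refine (isOpen_ball.measure_pos volume ⟨y, mem_ball_self hη⟩).ne' (?_ : volume (ball y η) = 0)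
    rw [measure_eq_zero_iff_ae_notMem]
    filter_upwards [hae] with z hz hzb
    exact hcon z hzb hz
  refine ⟨g x₀, ball y η, isOpen_ball, mem_ball_self hη, ?_⟩
  filter_upwards [hae] with z hz hzb
  refine tendsto_nhds_unique hz ?_
  simpa only [hc _ _ hx₀, hc _ _ hzb] using hx₀lim

end LocalValue

section PushforwardDensity

variable {ι : Type*} [Fintype ι]

theorem continuous_det_fderiv {ψ : EuclideanSpace ℝ ι → EuclideanSpace ℝ ι}
    (hψ : ContDiff ℝ ∞ ψ) : Continuous fun x => (fderiv ℝ ψ x).det :=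
  ContinuousLinearMap.continuous_det.comp (hψ.continuous_fderiv (by simp))

theorem ae_det_fderiv_eq_zero_of_preimage_null {ψ : EuclideanSpace ℝ ι → EuclideanSpace ℝ ι}
    (hψ : ContDiff ℝ ∞ ψ) {A : Set (EuclideanSpace ℝ ι)} (hA : MeasurableSet A)
    (hA0 : volume A = 0) : ∀ᵐ x, ψ x ∈ A → (fderiv ℝ ψ x).det = 0 := by
  rw [ae_iff]
  refine measure_null_of_locally_null _ fun x hx => ?_
  simp only [Classical.not_imp, mem_ofPred_eq] at hx
  have hstrict : HasStrictFDerivAt ψ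
      ((ContinuousLinearMap.toContinuousLinearEquivOfDetNeZero (fderiv ℝ ψ x) hx.2 :
        _ ≃L[ℝ] _) : EuclideanSpace ℝ ι →L[ℝ] EuclideanSpace ℝ ι) x := by
    simpa using hψ.contDiffAt.hasStrictFDerivAt (by simp)
  set e := hstrict.toOpenPartialHomeomorph ψ with he
  have hinj : InjOn ψ e.source := e.injOn
  set T := e.source ∩ ψ ⁻¹' A with hT
  have hTm : MeasurableSet T :=
    e.open_source.measurableSet.inter (hψ.continuous.measurable hA)
  have hint := lintegral_abs_det_fderiv_eq_addHaar_image volume hTm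
    (fun z _ => ((hψ.differentiable (by simp)) z).hasFDerivAt.hasFDerivWithinAt)
    (hinj.mono inter_subset_left)
  have h0 : volume (ψ '' T) = 0 :=
    measure_mono_null (by rintro _ ⟨z, hz, rfl⟩; exact hz.2) hA0
  rw [h0] at hint
  replace hint := (lintegral_eq_zero_iff
    (ENNReal.measurable_ofReal.comp (continuous_det_fderiv hψ).abs.measurable)).1 hint
  have hae : ∀ᵐ z, z ∈ T → (fderiv ℝ ψ z).det = 0 := by
    rw [← ae_restrict_iff' hTm]
    filter_upwards [hint] with z hz
    simpa using hz
  refine ⟨_, inter_mem_nhdsWithin _ (e.open_source.mem_nhds hstrict.mem_toOpenPartialHomeomorph_source),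
    measure_mono_null ?_ (ae_iff.1 hae)⟩
  rintro z ⟨hz, hzs⟩
  simp only [Classical.not_imp, mem_ofPred_eq] at hz ⊢
  exact ⟨⟨hzs, hz.1⟩, hz.2⟩

theorem exists_density_of_nonneg_weight {ψ : EuclideanSpace ℝ ι → EuclideanSpace ℝ ι}
    (hψ : Continuous ψ) {w : EuclideanSpace ℝ ι → ℝ} (hw : Continuous w) (hw0 : ∀ x, 0 ≤ w x)
    (hnull : ∀ A, MeasurableSet A → volume A = 0 → ∀ᵐ x, ψ x ∈ A → w x = 0)
    {B : Set (EuclideanSpace ℝ ι)} (hB : IsBounded B) :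
    ∃ g : EuclideanSpace ℝ ι → ℝ, Integrable g ∧ ∀ f : EuclideanSpace ℝ ι → ℝ,
      StronglyMeasurable f → (∃ C, ∀ x, ‖f x‖ ≤ C) →
        Integrable (fun x => g x * f x) ∧ ∫ x in B, w x * f (ψ x) = ∫ x, g x * f x := by
  set κ := (volume.restrict B).withDensity fun x => ENNReal.ofReal (w x) with hκ
  have hwm : Measurable fun x => (w x).toNNReal := (continuous_real_toNNReal.comp hw).measurable
  have hwB : IntegrableOn w B :=
    (hw.continuousOn.integrableOn_compact hB.isCompact_closure).mono_set subset_closure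
  have hfin : IsFiniteMeasure κ := by
    refine ⟨?_⟩
    rw [hκ, withDensity_apply _ MeasurableSet.univ, Measure.restrict_univ]
    exact hwB.lintegral_lt_top
  set ν := κ.map ψ with hν
  have hac : ν ≪ volume := by
    refine Measure.AbsolutelyContinuous.mk fun A hA hA0 => ?_
    rw [hν, Measure.map_apply hψ.measurable hA, hκ,
      withDensity_apply _ (hψ.measurable hA)]
    refine (lintegral_eq_zero_iff hwm.coe_nnreal_ennreal).2 ?_
    rw [EventuallyEq, ae_restrict_iff' (hψ.measurable hA)]
    refine ae_restrict_of_ae ?_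
    filter_upwards [hnull A hA hA0] with x hx hxA
    simp [hx hxA]
  refine ⟨fun x => (ν.rnDeriv volume x).toReal, Measure.integrable_toReal_rnDeriv, ?_⟩
  rintro f hf ⟨C, hC⟩
  constructor
  · rw [integrable_toReal_rnDeriv_mul_iff hac]
    exact Integrable.of_bound hf.aestronglyMeasurable C (Eventually.of_forall hC)
  · rw [integral_toReal_rnDeriv_mul hac, hν,
      integral_map hψ.measurable.aemeasurable hf.aestronglyMeasurable, hκ]
    have := integral_withDensity_eq_integral_smul (μ := volume.restrict B) hwm
      (fun x => f (ψ x))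
    refine Eq.trans ?_ this.symm
    refine integral_congr_ae (Eventually.of_forall fun x => ?_)
    simp [NNReal.smul_def, Real.coe_toNNReal _ (hw0 x)]

/-- The signed pushforward of `det (Dψ)` on a bounded set has an integrable density. -/
theorem exists_density {ψ : EuclideanSpace ℝ ι → EuclideanSpace ℝ ι}
    (hψ : ContDiff ℝ ∞ ψ) {B : Set (EuclideanSpace ℝ ι)} (hB : IsBounded B) :
    ∃ g : EuclideanSpace ℝ ι → ℝ, Integrable g ∧ ∀ f : EuclideanSpace ℝ ι → ℝ,
      StronglyMeasurable f → (∃ C, ∀ x, ‖f x‖ ≤ C) →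
        ∫ x in B, (fderiv ℝ ψ x).det * f (ψ x) = ∫ x, g x * f x := by
  have hd := continuous_det_fderiv hψ
  have hn := fun A hA hA0 => ae_det_fderiv_eq_zero_of_preimage_null hψ (A := A) hA hA0
  obtain ⟨g₁, hg₁, h₁⟩ := exists_density_of_nonneg_weight hψ.continuous
    (w := fun x => max (fderiv ℝ ψ x).det 0) (hd.max continuous_const) (fun x => le_max_right _ _)
    (fun A hA hA0 => by
      filter_upwards [hn A hA hA0] with x hx hxA
      simp [hx hxA]) hB
  obtain ⟨g₂, hg₂, h₂⟩ := exists_density_of_nonneg_weight hψ.continuous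
    (w := fun x => max (-(fderiv ℝ ψ x).det) 0) (hd.neg.max continuous_const)
    (fun x => le_max_right _ _)
    (fun A hA hA0 => by
      filter_upwards [hn A hA hA0] with x hx hxA
      simp [hx hxA]) hB
  refine ⟨fun x => g₁ x - g₂ x, hg₁.sub hg₂, fun f hf hfb => ?_⟩
  obtain ⟨C, hC⟩ := hfb
  have hint : ∀ w : EuclideanSpace ℝ ι → ℝ, Continuous w →
      IntegrableOn (fun x => w x * f (ψ x)) B := fun w hw =>
    ((hw.continuousOn.integrableOn_compact hB.isCompact_closure).mono_set
      subset_closure).mul_bdd (c := C)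
      (hf.comp_measurable hψ.continuous.measurable).aestronglyMeasurable
      (Eventually.of_forall fun x => hC _)
  simp only [sub_mul]
  rw [integral_sub (h₁ f hf ⟨C, hC⟩).1 (h₂ f hf ⟨C, hC⟩).1, ← (h₁ f hf ⟨C, hC⟩).2,
    ← (h₂ f hf ⟨C, hC⟩).2, ← integral_sub
      (hint (fun x => max (fderiv ℝ ψ x).det 0) (hd.max continuous_const))
      (hint (fun x => max (-(fderiv ℝ ψ x).det) 0) (hd.neg.max continuous_const))]
  refine integral_congr_ae (Eventually.of_forall fun x => ?_)
  simp only [← sub_mul]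
  congr 1
  rcases le_total 0 (fderiv ℝ ψ x).det with h | h
  · rw [max_eq_left h, max_eq_right (by linarith), sub_zero]
  · rw [max_eq_right h, max_eq_left (by linarith), zero_sub, neg_neg]

end PushforwardDensity

section LocalDegree

variable {ι : Type*} [Fintype ι] [DecidableEq ι]

theorem setIntegral_det_mul_fderiv_comp_eq_zero
    {ψ : EuclideanSpace ℝ ι → EuclideanSpace ℝ ι} (hψ : ContDiff ℝ ∞ ψ)
    {B : Set (EuclideanSpace ℝ ι)} (hBo : IsOpen B) (hB : IsBounded B)
    {f : EuclideanSpace ℝ ι → ℝ} (hf : ContDiff ℝ ∞ f)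
    (hdisj : Disjoint (tsupport f) (ψ '' frontier B)) (a : EuclideanSpace ℝ ι) :
    ∫ x in B, (fderiv ℝ ψ x).det * fderiv ℝ f (ψ x) a = 0 := by
  set v : EuclideanSpace ℝ ι → EuclideanSpace ℝ ι := B.indicator fun x => f (ψ x) • a with hv
  have hin : ∀ x ∈ B, v =ᶠ[𝓝 x] fun x => f (ψ x) • a := fun x hx => by
    filter_upwards [hBo.mem_nhds hx] with y hy
    rw [hv, indicator_of_mem hy]
  have hout : ∀ x ∉ B, v =ᶠ[𝓝 x] fun _ => 0 := fun x hx => by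
    by_cases hxc : x ∈ closure B
    · have hfr : x ∈ frontier B := by
        rw [hBo.frontier_eq]
        exact ⟨hxc, hx⟩
      have hxf : ψ x ∉ tsupport f := fun h =>
        Set.disjoint_left.1 hdisj h ⟨x, hfr, rfl⟩
      have := hψ.continuous.continuousAt.eventually
        ((isClosed_tsupport f).isOpen_compl.mem_nhds hxf)
      filter_upwards [this] with y hy
      have h0 : f (ψ y) = 0 := image_eq_zero_of_notMem_tsupport hy
      simp [hv, Set.indicator, h0]
    · filter_upwards [isClosed_closure.isOpen_compl.mem_nhds hxc] with y hy
      rw [hv, indicator_of_notMem fun h => hy (subset_closure h)]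
  have hsm : ContDiff ℝ ∞ fun x => f (ψ x) • a := (hf.comp hψ).smul contDiff_const
  have hvs : ContDiff ℝ ∞ v := contDiff_iff_contDiffAt.2 fun x => by
    by_cases hx : x ∈ B
    · exact hsm.contDiffAt.congr_of_eventuallyEq (hin x hx)
    · exact contDiffAt_const.congr_of_eventuallyEq (hout x hx)
  have hvc : HasCompactSupport v := by
    refine HasCompactSupport.intro hB.isCompact_closure fun x hx => ?_
    rw [hv, indicator_of_notMem fun h => hx (subset_closure h)]
  rw [← integral_indicator hBo.measurableSet,
    ← integral_sum_colDet_update_eq_zero hψ hvs hvc]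
  refine integral_congr_ae (Eventually.of_forall fun x => ?_)
  by_cases hx : x ∈ B
  · simp only [indicator_of_mem hx, (hin x hx).fderiv_eq]
    have hd : HasFDerivAt (fun x => f (ψ x) • a)
        (((fderiv ℝ f (ψ x)).comp (fderiv ℝ ψ x)).smulRight a) x :=
      (((hf.differentiable (by simp) _).hasFDerivAt).comp x
        ((hψ.differentiable (by simp) x).hasFDerivAt)).smul_const a
    simp only [hd.fderiv, ContinuousLinearMap.smulRight_apply, ContinuousLinearMap.comp_apply]
    have hc := congrArg (fderiv ℝ f (ψ x))
      (sum_colDet_update_smul (fun k => fderiv ℝ ψ x (stdVec k)) a)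
    rw [map_sum, map_smul, colDet_map, smul_eq_mul] at hc
    rw [← hc]
    refine Finset.sum_congr rfl fun j _ => ?_
    rw [ContinuousMultilinearMap.map_update_smul, map_smul, smul_eq_mul, smul_eq_mul, mul_comm]
  · simp only [indicator_of_notMem hx, (hout x hx).fderiv_eq]
    symm
    refine Finset.sum_eq_zero fun j _ => ?_
    refine (colDet ι).map_coord_zero j ?_
    simp

/-- The signed density `g` is locally constant off the image of the frontier. -/
theorem exists_hasLocalValue_density
    {ψ : EuclideanSpace ℝ ι → EuclideanSpace ℝ ι} (hψ : ContDiff ℝ ∞ ψ)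
    {B : Set (EuclideanSpace ℝ ι)} (hBo : IsOpen B) (hB : IsBounded B)
    {g : EuclideanSpace ℝ ι → ℝ} (hg : Integrable g)
    (h : ∀ f : EuclideanSpace ℝ ι → ℝ,
      StronglyMeasurable f → (∃ C, ∀ x, ‖f x‖ ≤ C) →
        ∫ x in B, (fderiv ℝ ψ x).det * f (ψ x) = ∫ x, g x * f x)
    {y : EuclideanSpace ℝ ι} (hy : y ∉ ψ '' frontier B) :
    ∃ c, HasLocalValue g y c := by
  have hK : IsClosed (ψ '' frontier B) :=
    ((hB.isCompact_closure.of_isClosed_subset isClosed_frontier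
      frontier_subset_closure).image hψ.continuous).isClosed
  obtain ⟨η, hη, hηK⟩ := Metric.isOpen_iff.1 hK.isOpen_compl y hy
  refine exists_hasLocalValue_of_weak_fderiv_eq_zero (η := η / 2) hg.locallyIntegrable
    (by positivity) fun f hf hfc hfs a => ?_
  rw [mul_div_cancel₀ _ two_ne_zero] at hfs
  have hc : Continuous fun z => fderiv ℝ f z a :=
    (hf.continuous_fderiv (by simp)).clm_apply continuous_const
  have hcs : HasCompactSupport fun z => fderiv ℝ f z a := hfc.fderiv_apply (𝕜 := ℝ) a
  rw [← h _ hc.stronglyMeasurable (hcs.exists_bound_of_continuous hc)]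
  refine setIntegral_det_mul_fderiv_comp_eq_zero hψ hBo hB hf ?_ a
  exact Set.disjoint_left.2 fun z hz hz' => hηK (hfs hz) hz'

theorem hasLocalValue_zero_of_notMem {κ : Type*} [Fintype κ]
    {ψ : EuclideanSpace ℝ κ → EuclideanSpace ℝ κ}
    {B K : Set (EuclideanSpace ℝ κ)} (hK : IsClosed K)
    (hBK : MapsTo ψ B K)
    {g : EuclideanSpace ℝ κ → ℝ} (hg : Integrable g)
    (h : ∀ f : EuclideanSpace ℝ κ → ℝ,
      StronglyMeasurable f → (∃ C, ∀ x, ‖f x‖ ≤ C) →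
        ∫ x in B, (fderiv ℝ ψ x).det * f (ψ x) = ∫ x, g x * f x)
    {y : EuclideanSpace ℝ κ} (hy : y ∉ K) : HasLocalValue g y 0 := by
  refine ⟨Kᶜ, hK.isOpen_compl, hy, ?_⟩
  rw [← ae_restrict_iff' hK.isOpen_compl.measurableSet]
  refine hg.integrableOn.ae_eq_zero_of_forall_setIntegral_eq_zero fun s hs _ => ?_
  rw [Measure.restrict_restrict hs]
  have hm : MeasurableSet (s ∩ Kᶜ) := hs.inter hK.isOpen_compl.measurableSet
  have := h ((s ∩ Kᶜ).indicator fun _ => 1) (stronglyMeasurable_const.indicator hm)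
    ⟨1, fun x => by by_cases hx : x ∈ s ∩ Kᶜ <;> simp [Set.indicator, hx]⟩
  rw [← integral_indicator hm]
  refine (integral_congr_ae (Eventually.of_forall fun x => ?_)).trans (this.symm.trans ?_)
  · by_cases hx : x ∈ s ∩ Kᶜ <;> simp [Set.indicator, hx]
  · refine setIntegral_eq_zero_of_forall_eq_zero fun x hx => ?_
    rw [indicator_of_notMem fun hh => hh.2 (hBK hx), mul_zero]

end LocalDegree

section DensityJump

variable {ι : Type*} [Fintype ι]

theorem measurableSet_image_of_injOn_contDiff
    {ψ : EuclideanSpace ℝ ι → EuclideanSpace ℝ ι} (hψ : ContDiff ℝ ∞ ψ)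
    {A : Set (EuclideanSpace ℝ ι)} (hA : MeasurableSet A) (hinj : InjOn ψ A) :
    MeasurableSet (ψ '' A) :=
  hA.image_of_continuousOn_injOn hψ.continuous.continuousOn hinj

theorem volume_image_of_injOn_of_abs_det_eq_one
    {ψ : EuclideanSpace ℝ ι → EuclideanSpace ℝ ι} (hψ : ContDiff ℝ ∞ ψ)
    {A : Set (EuclideanSpace ℝ ι)} (hA : MeasurableSet A) (hinj : InjOn ψ A)
    (hdet : ∀ x ∈ A, |(fderiv ℝ ψ x).det| = 1) : volume (ψ '' A) = volume A := by
  rw [← lintegral_abs_det_fderiv_eq_addHaar_image volume hA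
    (fun x _ => (hψ.differentiable (by simp) x).hasFDerivAt.hasFDerivWithinAt) hinj,
    setLIntegral_congr_fun hA (g := fun _ => 1) (fun x hx => by simp [hdet x hx])]
  simp

/-- The density of the larger set differs from that of the smaller one by the sign of the
Jacobian on the image of the difference. -/
theorem density_eq_add_indicator
    {ψ : EuclideanSpace ℝ ι → EuclideanSpace ℝ ι} (hψ : ContDiff ℝ ∞ ψ)
    {B B' : Set (EuclideanSpace ℝ ι)} (hBB : B ⊆ B') (hB : MeasurableSet B)
    (hB' : MeasurableSet B') (hbdd : IsBounded B')
    (hinj : InjOn ψ (B' \ B)) {s : ℝ} (hs : |s| = 1)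
    (hdet : ∀ x ∈ B' \ B, (fderiv ℝ ψ x).det = s)
    {g g' : EuclideanSpace ℝ ι → ℝ} (hg : Integrable g) (hg' : Integrable g')
    (h : ∀ f : EuclideanSpace ℝ ι → ℝ,
      StronglyMeasurable f → (∃ C, ∀ x, ‖f x‖ ≤ C) →
        ∫ x in B, (fderiv ℝ ψ x).det * f (ψ x) = ∫ x, g x * f x)
    (h' : ∀ f : EuclideanSpace ℝ ι → ℝ,
      StronglyMeasurable f → (∃ C, ∀ x, ‖f x‖ ≤ C) →
        ∫ x in B', (fderiv ℝ ψ x).det * f (ψ x) = ∫ x, g' x * f x) :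
    ∀ᵐ y, g' y = g y + (ψ '' (B' \ B)).indicator (fun _ => s) y := by
  have hAm : MeasurableSet (B' \ B) := hB'.diff hB
  have hWm := measurableSet_image_of_injOn_contDiff hψ hAm hinj
  have hvol := volume_image_of_injOn_of_abs_det_eq_one hψ hAm hinj
    fun x hx => by rw [hdet x hx, hs]
  have hWint : Integrable ((ψ '' (B' \ B)).indicator fun _ => s) := by
    refine (integrableOn_const ?_).integrable_indicator hWm
    rw [hvol]
    exact (hbdd.subset sdiff_subset).measure_lt_top.ne
  refine Integrable.ae_eq_of_forall_setIntegral_eq _ _ hg' (hg.add hWint) fun S hS _ => ?_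
  have hf : StronglyMeasurable (S.indicator fun _ => (1 : ℝ)) :=
    stronglyMeasurable_const.indicator hS
  have hfb : ∃ C, ∀ x, ‖S.indicator (fun _ => (1 : ℝ)) x‖ ≤ C :=
    ⟨1, fun x => by by_cases hx : x ∈ S <;> simp [Set.indicator, hx]⟩
  have hind : ∀ k : EuclideanSpace ℝ ι → ℝ,
      ∫ x in S, k x = ∫ x, k x * S.indicator (fun _ => (1 : ℝ)) x := fun k => by
    rw [← integral_indicator hS]
    refine integral_congr_ae (Eventually.of_forall fun x => ?_)
    by_cases hx : x ∈ S <;> simp [Set.indicator, hx]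
  rw [integral_add hg.integrableOn hWint.integrableOn, hind g, hind g', ← h _ hf hfb,
    ← h' _ hf hfb]
  have hint : IntegrableOn
      (fun x => (fderiv ℝ ψ x).det * S.indicator (fun _ => (1 : ℝ)) (ψ x)) B' := by
    obtain ⟨C, hC⟩ := hfb
    exact (((continuous_det_fderiv hψ).continuousOn.integrableOn_compact
      hbdd.isCompact_closure).mono_set subset_closure).mul_bdd (c := C)
      (hf.comp_measurable hψ.continuous.measurable).aestronglyMeasurable
      (Eventually.of_forall fun x => hC _)
  rw [← sub_eq_iff_eq_add', ← setIntegral_sdiff hB hint hBB,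
    setIntegral_indicator hWm, inter_comm, ← setIntegral_indicator hS,
    integral_image_eq_integral_abs_det_fderiv_smul volume hAm
    (fun x _ => (hψ.differentiable (by simp) x).hasFDerivAt.hasFDerivWithinAt) hinj]
  refine setIntegral_congr_fun hAm fun x hx => ?_
  simp only [hdet x hx, hs]
  by_cases hxS : ψ x ∈ S <;> simp [Set.indicator, hxS]

end DensityJump

section StandardComplexStructure

variable {n : ℕ}

theorem sum_fin_two_mul (f : Fin (2 * n) → ℝ) :
    ∑ i, f i = ∑ i : Fin n, (f ⟨2 * i.1, by have := i.isLt; omega⟩ +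
      f ⟨2 * i.1 + 1, by have := i.isLt; omega⟩) := by
  rw [← ((finProdFinEquiv (m := n) (n := 2)).trans (finCongr (mul_comm n 2))).sum_comp,
    Fintype.sum_prod_type]
  refine Finset.sum_congr rfl fun i _ => ?_
  rw [Fin.sum_univ_two]
  congr 2 <;> ext <;> simp [add_comm]

/-- The index of the coordinate conjugate to the `i`-th one. -/
def conjIndex (i : Fin (2 * n)) : Fin (2 * n) :=
  if h : i.1 % 2 = 0 then ⟨i.1 + 1, by have := i.isLt; omega⟩
  else ⟨i.1 - 1, by have := i.isLt; omega⟩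

/-- The standard complex structure on `ℝ^{2n}`. -/
def stdJ (n : ℕ) : R2n n →L[ℝ] R2n n :=
  LinearMap.toContinuousLinearMap
    { toFun := fun x => WithLp.toLp 2 fun i => (if i.1 % 2 = 0 then -1 else 1) * x (conjIndex i)
      map_add' := fun x y => by
        ext i
        exact mul_add _ _ _
      map_smul' := fun c x => by
        ext i
        exact mul_left_comm _ _ _ }

theorem stdJ_apply (x : R2n n) (i : Fin (2 * n)) :
    stdJ n x i = (if i.1 % 2 = 0 then -1 else 1) * x (conjIndex i) := rfl

theorem stdJ_even (x : R2n n) (i : Fin n) :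
    stdJ n x ⟨2 * i.1, by have := i.isLt; omega⟩ =
      -x ⟨2 * i.1 + 1, by have := i.isLt; omega⟩ := by
  have h : conjIndex (n := n) ⟨2 * i.1, by have := i.isLt; omega⟩ =
      ⟨2 * i.1 + 1, by have := i.isLt; omega⟩ := dif_pos (by simp)
  rw [stdJ_apply, h, if_pos (by simp), neg_one_mul]

theorem stdJ_odd (x : R2n n) (i : Fin n) :
    stdJ n x ⟨2 * i.1 + 1, by have := i.isLt; omega⟩ =
      x ⟨2 * i.1, by have := i.isLt; omega⟩ := by
  have h : conjIndex (n := n) ⟨2 * i.1 + 1, by have := i.isLt; omega⟩ =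
      ⟨2 * i.1, by have := i.isLt; omega⟩ := dif_neg (by simp)
  rw [stdJ_apply, h, if_neg (by simp), one_mul]

theorem sympForm_eq_inner (v w : R2n n) : sympForm n v w = inner ℝ (stdJ n v) w := by
  rw [PiLp.inner_apply, sum_fin_two_mul, sympForm]
  refine Finset.sum_congr rfl fun i _ => ?_
  rw [stdJ_even, stdJ_odd]
  simp
  ring

theorem inner_stdJ_left (v w : R2n n) : inner ℝ (stdJ n v) w = -inner ℝ v (stdJ n w) := by
  rw [real_inner_comm (stdJ n w) v, ← sympForm_eq_inner, ← sympForm_eq_inner, sympForm, sympForm,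
    ← Finset.sum_neg_distrib]
  exact Finset.sum_congr rfl fun i _ => by ring

theorem stdJ_stdJ (v : R2n n) : stdJ n (stdJ n v) = -v := by
  refine ext_inner_right ℝ fun w => ?_
  rw [PiLp.inner_apply, PiLp.inner_apply, sum_fin_two_mul, sum_fin_two_mul]
  refine Finset.sum_congr rfl fun i _ => ?_
  rw [stdJ_even, stdJ_odd, stdJ_odd, stdJ_even]
  simp

theorem inner_stdJ_stdJ (v w : R2n n) : inner ℝ (stdJ n v) (stdJ n w) = inner ℝ v w := by
  rw [inner_stdJ_left, stdJ_stdJ, inner_neg_right, neg_neg]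

theorem inner_stdJ_self (v : R2n n) : inner ℝ (stdJ n v) v = 0 := by
  have h := inner_stdJ_left v v
  rw [real_inner_comm] at h
  rw [real_inner_comm]
  linarith

/-- The standard symplectic form as a continuous bilinear map. -/
def sympB (n : ℕ) : R2n n →L[ℝ] R2n n →L[ℝ] ℝ := (innerSL ℝ).comp (stdJ n)

theorem sympB_apply (v w : R2n n) : sympB n v w = inner ℝ (stdJ n v) w := rfl

theorem sympB_swap (v w : R2n n) : sympB n v w = -sympB n w v := by
  rw [sympB_apply, sympB_apply, inner_stdJ_left, real_inner_comm]

theorem sympB_stdJ (v w : R2n n) : sympB n v (stdJ n w) = inner ℝ v w :=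
  inner_stdJ_stdJ v w

theorem det_mul_self_eq_one_of_sympB {L : R2n n →L[ℝ] R2n n}
    (hL : ∀ v w, sympB n (L v) (L w) = sympB n v w) : L.det * L.det = 1 := by
  set l : R2n n →ₗ[ℝ] R2n n := (L : R2n n →ₗ[ℝ] R2n n) with hl
  set j : R2n n →ₗ[ℝ] R2n n := (stdJ n : R2n n →ₗ[ℝ] R2n n) with hj
  have hadj : LinearMap.det (LinearMap.adjoint l) = LinearMap.det l := by
    have b := EuclideanSpace.basisFun (Fin (2 * n)) ℝ
    rw [← LinearMap.det_toMatrix b.toBasis, ← LinearMap.det_toMatrix b.toBasis l,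
      LinearMap.toMatrix_adjoint, Matrix.det_conjTranspose]
    simp
  have hcomp : LinearMap.adjoint l ∘ₗ j ∘ₗ l = j := by
    ext1 v
    refine ext_inner_right ℝ fun w => ?_
    rw [LinearMap.comp_apply, LinearMap.adjoint_inner_left]
    exact hL v w
  have hjj : LinearMap.det j * LinearMap.det j ≠ 0 := by
    rw [← LinearMap.det_comp]
    have : j ∘ₗ j = (-1 : ℝ) • LinearMap.id := by
      ext1 v
      change stdJ n (stdJ n v) = (-1 : ℝ) • v
      rw [stdJ_stdJ, neg_one_smul]
    rw [this, LinearMap.det_smul]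
    simp
  have h := congrArg LinearMap.det hcomp
  rw [LinearMap.det_comp, LinearMap.det_comp, hadj] at h
  have hj0 := left_ne_zero_of_mul hjj
  change LinearMap.det l * LinearMap.det l = 1
  refine mul_left_cancel₀ hj0 ?_
  linarith

end StandardComplexStructure

section CircleAction

theorem integral_integral_two_mul_bilin_eq {E : Type*} [NormedAddCommGroup E] [NormedSpace ℝ E]
    (B : E →L[ℝ] E →L[ℝ] ℝ) (hB : ∀ v w, B v w = -B w v) {u : ℝ × ℝ → E}
    (hu : ContDiff ℝ ∞ u) (hper : ∀ p, u (p + (0, 2 * π)) = u p)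
    (hrefl : ∀ t, u (π, t) = u (0, -t)) :
    ∫ s in (0 : ℝ)..π, ∫ t in (0 : ℝ)..(2 * π),
        2 * B (fderiv ℝ u (s, t) (1, 0)) (fderiv ℝ u (s, t) (0, 1)) =
      -(2 * ∫ t in (0 : ℝ)..(2 * π), B (u (0, t)) (fderiv ℝ u (0, t) (0, 1))) := by
  have hD : ContDiff ℝ ∞ (fderiv ℝ u) := hu.fderiv_right (m := ∞) (by simp)
  have hud : ∀ p, HasFDerivAt u (fderiv ℝ u p) p := fun p =>
    (hu.differentiable (by simp) p).hasFDerivAt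
  have hDd : ∀ p, HasFDerivAt (fderiv ℝ u) (fderiv ℝ (fderiv ℝ u) p) p := fun p =>
    (hD.differentiable (by simp) p).hasFDerivAt
  have hsymm : ∀ p a b, fderiv ℝ (fderiv ℝ u) p a b = fderiv ℝ (fderiv ℝ u) p b a :=
    fun p a b => (hu.contDiffAt).isSymmSndFDerivAt
      (by simpa using WithTop.coe_le_coe.2 (le_top : (2 : ℕ∞) ≤ ⊤)) a b
  have hda : ∀ p a, HasFDerivAt (fun p => B (u p) (fderiv ℝ u p a))
      ((B (u p)).comp ((fderiv ℝ (fderiv ℝ u) p).flip a) +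
        (B.flip (fderiv ℝ u p a)).comp (fderiv ℝ u p)) p := fun p a => by
    have h1 := (hDd p).clm_apply (hasFDerivAt_const a p)
    have h2 := B.hasFDerivAt_of_bilinear (hud p) h1
    refine h2.congr_fderiv ?_
    ext <;> simp
  have hca : ∀ a, Continuous fun p => B (u p) (fderiv ℝ u p a) := fun a =>
    continuous_iff_continuousAt.2 fun p => (hda p a).continuousAt
  have hkey : ∀ p, ((B (u p)).comp ((fderiv ℝ (fderiv ℝ u) p).flip (0, 1)) +
        (B.flip (fderiv ℝ u p (0, 1))).comp (fderiv ℝ u p)) (1, 0) +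
      (-((B (u p)).comp ((fderiv ℝ (fderiv ℝ u) p).flip (1, 0)) +
        (B.flip (fderiv ℝ u p (1, 0))).comp (fderiv ℝ u p))) (0, 1) =
      2 * B (fderiv ℝ u p (1, 0)) (fderiv ℝ u p (0, 1)) := fun p => by
    simp only [add_apply, neg_apply, ContinuousLinearMap.comp_apply,
      ContinuousLinearMap.flip_apply]
    rw [hsymm p (1, 0) (0, 1), hB (fderiv ℝ u p (0, 1))]
    ring
  have hcont : Continuous fun p => 2 * B (fderiv ℝ u p (1, 0)) (fderiv ℝ u p (0, 1)) := by
    have h1 : Continuous fun p => fderiv ℝ u p (1, 0) := hD.continuous.clm_apply continuous_const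
    have h2 : Continuous fun p => fderiv ℝ u p (0, 1) := hD.continuous.clm_apply continuous_const
    exact continuous_const.mul ((B.continuous.comp h1).clm_apply h2)
  have hdiv := integral2_divergence_prod_of_hasFDerivAt
    (fun p => B (u p) (fderiv ℝ u p (0, 1))) (fun p => -B (u p) (fderiv ℝ u p (1, 0)))
    _ _ 0 0 π (2 * π) (hca _).continuousOn (hca _).neg.continuousOn
    (fun p _ => hda p _) (fun p _ => (hda p _).neg) (by
      simp only [hkey]
      exact hcont.continuousOn.integrableOn_compact (isCompact_uIcc.prod isCompact_uIcc))
  simp only [hkey] at hdiv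
  rw [hdiv]
  have hfper : ∀ p a, fderiv ℝ u (p + (0, 2 * π)) a = fderiv ℝ u p a := fun p a => by
    rw [← fderiv_comp_add_right]
    simp only [hper]
  have hper0 : ∀ s, u (s, 2 * π) = u (s, 0) := fun s => by
    simpa using hper (s, 0)
  have hfper0 : ∀ s a, fderiv ℝ u (s, 2 * π) a = fderiv ℝ u (s, 0) a := fun s a => by
    simpa using hfper (s, 0) a
  have hfrefl : ∀ t, fderiv ℝ u (π, t) (0, 1) = -fderiv ℝ u (0, -t) (0, 1) := fun t => by
    have h1 : HasDerivAt (fun t => u (π, t)) (fderiv ℝ u (π, t) (0, 1)) t :=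
      (hud (π, t)).comp_hasDerivAt t ((hasDerivAt_const t π).prodMk (hasDerivAt_id t))
    have h2 : HasDerivAt (fun t => u (0, -t)) (fderiv ℝ u (0, -t) (0, -1)) t :=
      (hud (0, -t)).comp_hasDerivAt t ((hasDerivAt_const t (0 : ℝ)).prodMk (hasDerivAt_neg t))
    simp only [hrefl] at h1
    rw [h1.unique h2, ← map_neg]
    simp
  have hpi : ∫ t in (0 : ℝ)..(2 * π), B (u (π, t)) (fderiv ℝ u (π, t) (0, 1)) =
      -∫ t in (0 : ℝ)..(2 * π), B (u (0, t)) (fderiv ℝ u (0, t) (0, 1)) := by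
    simp only [hfrefl, hrefl, map_neg]
    rw [intervalIntegral.integral_neg, intervalIntegral.integral_comp_neg
      (fun t => B (u (0, t)) (fderiv ℝ u (0, t) (0, 1)))]
    have hp : Function.Periodic (fun t => B (u (0, t)) (fderiv ℝ u (0, t) (0, 1))) (2 * π) :=
      fun t => by
        have h1 := hper (0, t)
        have h2 := hfper (0, t) (0, 1)
        simp only [Prod.mk_add_mk, add_zero] at h1 h2
        simp only [h1, h2]
    have := hp.intervalIntegral_add_eq (-(2 * π)) 0
    simp only [neg_add_cancel, zero_add] at this
    rw [neg_zero, this]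
  simp only [hper0, hfper0]
  rw [hpi]
  ring

variable {n : ℕ}

theorem exists_norm_eq_orthogonal_stdJ (hn : 2 ≤ n) (x : R2n n) :
    ∃ z : R2n n, ‖z‖ = ‖x‖ ∧ inner ℝ x z = 0 ∧ inner ℝ (stdJ n x) z = 0 := by
  set S : Submodule ℝ (R2n n) := Submodule.span ℝ {x, stdJ n x} with hS
  have hne : Sᗮ ≠ ⊥ := fun h => by
    have htop : S = ⊤ := (Submodule.orthogonal_eq_bot_iff).1 h
    have h1 : Module.finrank ℝ S ≤ 2 := by
      refine (finrank_span_le_card ({x, stdJ n x} : Set (R2n n))).trans ?_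
      rw [Set.toFinset_card, ← Nat.card_eq_fintype_card, Nat.card_coe_set_eq]
      exact (Set.ncard_insert_le _ _).trans (by simp)
    rw [htop, finrank_top, finrank_euclideanSpace_fin] at h1
    omega
  obtain ⟨w, hwS, hw0⟩ := Submodule.exists_mem_ne_zero_of_ne_bot hne
  have h1 : inner ℝ x w = 0 := hwS x (Submodule.subset_span (by simp))
  have h2 : inner ℝ (stdJ n x) w = 0 := hwS _ (Submodule.subset_span (by simp))
  refine ⟨(‖x‖ / ‖w‖) • w, ?_, ?_, ?_⟩
  · rw [norm_smul, norm_div, norm_norm, norm_norm, div_mul_cancel₀ _ (norm_ne_zero_iff.2 hw0)]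
  · rw [inner_smul_right, h1, mul_zero]
  · rw [inner_smul_right, h2, mul_zero]

/-- The Hopf flow. -/
def hopf (n : ℕ) (t : ℝ) (x : R2n n) : R2n n := cos t • x + sin t • stdJ n x

/-- A map which is symplectic along a round sphere preserves the action of its Hopf circles. -/
theorem integral_sympB_hopf_eq (hn : 2 ≤ n) {ψ : R2n n → R2n n} (hψ : ContDiff ℝ ∞ ψ)
    (x : R2n n) (hs : ∀ y, ‖y‖ = ‖x‖ → ∀ v w,
      sympB n (fderiv ℝ ψ y v) (fderiv ℝ ψ y w) = sympB n v w) :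
    ∫ t in (0 : ℝ)..(2 * π), sympB n (ψ (hopf n t x))
        (fderiv ℝ ψ (hopf n t x) (stdJ n (hopf n t x))) =
      ∫ t in (0 : ℝ)..(2 * π), sympB n (hopf n t x) (stdJ n (hopf n t x)) := by
  obtain ⟨z, hz, hxz, hJz⟩ := exists_norm_eq_orthogonal_stdJ hn x
  set Γ : ℝ × ℝ → R2n n := fun p =>
    cos p.2 • x + sin p.2 • (cos p.1 • stdJ n x + sin p.1 • z) with hΓ
  have hΓs : ContDiff ℝ ∞ Γ := by
    have h1 : ContDiff ℝ ∞ fun p : ℝ × ℝ => p.1 := contDiff_fst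
    have h2 : ContDiff ℝ ∞ fun p : ℝ × ℝ => p.2 := contDiff_snd
    exact (h2.cos.smul contDiff_const).add (h2.sin.smul
      ((h1.cos.smul contDiff_const).add (h1.sin.smul contDiff_const)))
  have hΓn : ∀ p, ‖Γ p‖ = ‖x‖ := fun p => by
    have hxJ : inner ℝ x (stdJ n x) = 0 := by rw [real_inner_comm, inner_stdJ_self]
    have hJx : inner ℝ (stdJ n x) x = 0 := inner_stdJ_self x
    have hzx : inner ℝ z x = 0 := by rw [real_inner_comm, hxz]
    have hzJ : inner ℝ z (stdJ n x) = 0 := by rw [real_inner_comm, hJz]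
    have hx2 : inner ℝ x x = ‖x‖ ^ 2 := real_inner_self_eq_norm_sq x
    have hJ2 : inner ℝ (stdJ n x) (stdJ n x) = ‖x‖ ^ 2 := by rw [inner_stdJ_stdJ, hx2]
    have hz2 : inner ℝ z z = ‖x‖ ^ 2 := by rw [real_inner_self_eq_norm_sq, hz]
    refine (sq_eq_sq₀ (norm_nonneg _) (norm_nonneg _)).1 ?_
    rw [← real_inner_self_eq_norm_sq, hΓ]
    simp only [inner_add_left, inner_add_right, real_inner_smul_left, real_inner_smul_right,
      hxJ, hJx, hzx, hzJ, hxz, hJz, hx2, hJ2, hz2]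
    have e1 := sin_sq_add_cos_sq p.1
    have e2 := sin_sq_add_cos_sq p.2
    have e3 : sin p.2 ^ 2 * (sin p.1 ^ 2 + cos p.1 ^ 2) + cos p.2 ^ 2 = 1 := by
      rw [e1, mul_one, e2]
    linear_combination ‖x‖ ^ 2 * e3
  have hΓp : ∀ p, Γ (p + (0, 2 * π)) = Γ p := fun p => by simp [hΓ]
  have hΓr : ∀ t, Γ (π, t) = Γ (0, -t) := fun t => by simp [hΓ]
  have hΓ0 : ∀ t, Γ (0, t) = hopf n t x := fun t => by simp [hΓ, hopf]
  have hΓt : ∀ t, fderiv ℝ Γ (0, t) (0, 1) = stdJ n (hopf n t x) := fun t => by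
    have h1 : HasDerivAt (fun t => Γ (0, t)) (fderiv ℝ Γ (0, t) (0, 1)) t :=
      (hΓs.differentiable (by simp) (0, t)).hasFDerivAt.comp_hasDerivAt t
        ((hasDerivAt_const t (0 : ℝ)).prodMk (hasDerivAt_id t))
    simp only [hΓ0] at h1
    have h2 : HasDerivAt (fun t => hopf n t x) (-sin t • x + cos t • stdJ n x) t :=
      ((hasDerivAt_cos t).smul_const x).add ((hasDerivAt_sin t).smul_const _)
    rw [h1.unique h2, hopf, map_add, map_smul, map_smul, stdJ_stdJ, smul_neg, neg_smul, add_comm]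
  have hψΓ : ∀ p v, fderiv ℝ (ψ ∘ Γ) p v = fderiv ℝ ψ (Γ p) (fderiv ℝ Γ p v) := fun p v => by
    rw [fderiv_comp _ (hψ.differentiable (by simp) _) (hΓs.differentiable (by simp) _)]
    rfl
  have k1 := integral_integral_two_mul_bilin_eq (sympB n) sympB_swap (hψ.comp hΓs)
    (fun p => congrArg ψ (hΓp p)) (fun t => congrArg ψ (hΓr t))
  have k2 := integral_integral_two_mul_bilin_eq (sympB n) sympB_swap hΓs hΓp hΓr
  simp only [hψΓ, hs _ (hΓn _), Function.comp_apply] at k1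
  rw [k1] at k2
  simp only [hΓt, hΓ0] at k2
  linarith

end CircleAction

section HopfAveraging

variable {n : ℕ}

theorem norm_hopf (t : ℝ) (x : R2n n) : ‖hopf n t x‖ = ‖x‖ := by
  refine (sq_eq_sq₀ (norm_nonneg _) (norm_nonneg _)).1 ?_
  have hxJ : inner ℝ x (stdJ n x) = 0 := by rw [real_inner_comm, inner_stdJ_self]
  have hx2 : inner ℝ x x = ‖x‖ ^ 2 := real_inner_self_eq_norm_sq x
  have hJ2 : inner ℝ (stdJ n x) (stdJ n x) = ‖x‖ ^ 2 := by rw [inner_stdJ_stdJ, hx2]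
  rw [← real_inner_self_eq_norm_sq, hopf]
  simp only [inner_add_left, inner_add_right, real_inner_smul_left, real_inner_smul_right,
    hxJ, inner_stdJ_self, hx2, hJ2]
  linear_combination ‖x‖ ^ 2 * sin_sq_add_cos_sq t

/-- The Hopf flow as a linear isometry. -/
def hopfEquiv (n : ℕ) (t : ℝ) : R2n n ≃ₗᵢ[ℝ] R2n n :=
  LinearIsometry.toLinearIsometryEquiv
    { toLinearMap := cos t • LinearMap.id + sin t • (stdJ n : R2n n →ₗ[ℝ] R2n n)
      norm_map' := fun x => by
        rw [LinearMap.add_apply, LinearMap.smul_apply, LinearMap.smul_apply]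
        exact norm_hopf t x } rfl

theorem continuous_hopf : Continuous fun p : ℝ × R2n n => hopf n p.1 p.2 :=
  ((continuous_cos.comp continuous_fst).smul continuous_snd).add
    ((continuous_sin.comp continuous_fst).smul ((stdJ n).continuous.comp continuous_snd))

theorem integral_comp_hopf (F : R2n n → ℝ) (t : ℝ) : ∫ x, F (hopf n t x) = ∫ x, F x :=
  (hopfEquiv n t).measurePreserving.integral_comp
    (hopfEquiv n t).toHomeomorph.measurableEmbedding F

theorem integral_eq_zero_of_hopf {F : R2n n → ℝ} (hF : Continuous F) (hc : HasCompactSupport F)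
    (h0 : ∀ x, ∫ t in (0 : ℝ)..(2 * π), F (hopf n t x) = 0) : ∫ x, F x = 0 := by
  have hint : Integrable F := hF.integrable_of_hasCompactSupport hc
  have hprod : Integrable (Function.uncurry fun t x => F (hopf n t x))
      ((volume.restrict (Ioc 0 (2 * π))).prod volume) := by
    refine (integrable_prod_iff (hF.comp continuous_hopf).aestronglyMeasurable).2 ⟨?_, ?_⟩
    · refine Eventually.of_forall fun t => ?_
      exact (hopfEquiv n t).measurePreserving.integrable_comp_of_integrable hint
    · change Integrable (fun t => ∫ x, ‖F (hopf n t x)‖) _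
      simp only [integral_comp_hopf (fun x => ‖F x‖)]
      exact integrable_const _
  have h := integral_integral_swap hprod
  simp only [integral_comp_hopf, integral_const] at h
  have h0' : ∀ x, ∫ t in Ioc 0 (2 * π), F (hopf n t x) = 0 := fun x => by
    rw [← intervalIntegral.integral_of_le (by positivity)]
    exact h0 x
  simp only [h0', integral_zero, smul_eq_mul, mul_eq_zero] at h
  refine h.resolve_left ?_
  have : 0 < 2 * π := by positivity
  simp [this.le, Real.pi_ne_zero]

theorem contDiff_comp_norm_sq {κ : ℝ → ℝ} (hκ : ContDiff ℝ ∞ κ) :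
    ContDiff ℝ ∞ fun x : R2n n => κ (‖x‖ ^ 2) :=
  hκ.comp (contDiff_norm_sq ℝ)

theorem fderiv_comp_norm_sq {κ : ℝ → ℝ} (hκ : ContDiff ℝ ∞ κ) (x v : R2n n) :
    fderiv ℝ (fun x : R2n n => κ (‖x‖ ^ 2)) x v = deriv κ (‖x‖ ^ 2) * (2 * inner ℝ x v) := by
  have h1 : HasDerivAt κ (deriv κ (‖x‖ ^ 2)) (‖x‖ ^ 2) :=
    (hκ.differentiable (by simp) _).hasDerivAt
  have h2 : HasFDerivAt (fun x : R2n n => ‖x‖ ^ 2) (2 • innerSL ℝ x) x :=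
    (hasStrictFDerivAt_norm_sq x).hasFDerivAt
  have := (h1.comp_hasFDerivAt x h2).fderiv
  rw [Function.comp_def] at this
  rw [this]
  simp

theorem hasCompactSupport_of_norm_sq {F : R2n n → ℝ} {R : ℝ} (hR : 0 ≤ R)
    (h : ∀ x, R ^ 2 < ‖x‖ ^ 2 → F x = 0) : HasCompactSupport F := by
  refine HasCompactSupport.intro (isCompact_closedBall (0 : R2n n) R) fun x hx => h x ?_
  rw [mem_closedBall_zero_iff, not_le] at hx
  gcongr

/-- The flux identity for a radial cutoff of a map which is symplectic where the cutoff is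
not locally constant. -/
theorem integral_cutoff_det_add_flux_eq_zero {ψ : R2n n → R2n n} (hψ : ContDiff ℝ ∞ ψ)
    {κ : ℝ → ℝ} (hκ : ContDiff ℝ ∞ κ) {R : ℝ} (hR : 0 ≤ R) (hκ0 : ∀ t, R ^ 2 < t → κ t = 0)
    {s : ℝ} (hs : ∀ x, deriv κ (‖x‖ ^ 2) ≠ 0 → (fderiv ℝ ψ x).det = s ∧
      ∀ v w, sympB n (fderiv ℝ ψ x v) (fderiv ℝ ψ x w) = sympB n v w) :
    ∫ x, ((2 * n : ℕ) * (κ (‖x‖ ^ 2) * (fderiv ℝ ψ x).det) +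
      2 * s * (deriv κ (‖x‖ ^ 2) * sympB n (ψ x) (fderiv ℝ ψ x (stdJ n x)))) = 0 := by
  have hχ := contDiff_comp_norm_sq (n := n) hκ
  have hχc : HasCompactSupport fun x : R2n n => κ (‖x‖ ^ 2) :=
    hasCompactSupport_of_norm_sq hR fun x hx => hκ0 _ hx
  have hv : ContDiff ℝ ∞ fun x => κ (‖x‖ ^ 2) • ψ x := hχ.smul hψ
  have hvc : HasCompactSupport fun x => κ (‖x‖ ^ 2) • ψ x := hχc.smul_right
  rw [← integral_sum_colDet_update_eq_zero hψ hv hvc]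
  refine integral_congr_ae (Eventually.of_forall fun x => ?_)
  set V : Fin (2 * n) → R2n n := fun k => fderiv ℝ ψ x (stdVec k) with hV
  have hfd : ∀ a, fderiv ℝ (fun x => κ (‖x‖ ^ 2) • ψ x) x a =
      κ (‖x‖ ^ 2) • fderiv ℝ ψ x a + (deriv κ (‖x‖ ^ 2) * (2 * inner ℝ x a)) • ψ x := fun a => by
    rw [fderiv_fun_smul (hχ.differentiable (by simp) x) (hψ.differentiable (by simp) x)]
    simp [fderiv_comp_norm_sq hκ]
  have hterm : ∀ j, colDet _ (Function.update V j
      (fderiv ℝ (fun x => κ (‖x‖ ^ 2) • ψ x) x (stdVec j))) =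
      κ (‖x‖ ^ 2) * (fderiv ℝ ψ x).det + 2 * deriv κ (‖x‖ ^ 2) *
        inner ℝ x (colDet _ (Function.update V j (ψ x)) • stdVec j) := fun j => by
    rw [hfd, ContinuousMultilinearMap.map_update_add, ContinuousMultilinearMap.map_update_smul,
      ContinuousMultilinearMap.map_update_smul, real_inner_smul_right]
    have : Function.update V j (fderiv ℝ ψ x (stdVec j)) = V := Function.update_eq_self j V
    rw [this, colDet_map, smul_eq_mul, smul_eq_mul]
    ring
  simp only [← hV, hterm]
  rw [Finset.sum_add_distrib, ← Finset.mul_sum _ _ (2 * _), ← inner_sum]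
  simp only [Finset.sum_const, Finset.card_univ, Fintype.card_fin, nsmul_eq_mul]
  congr 1
  by_cases h0 : deriv κ (‖x‖ ^ 2) = 0
  · simp [h0]
  obtain ⟨hdet, hsymp⟩ := hs x h0
  set c := ∑ j, colDet _ (Function.update V j (ψ x)) • stdVec j with hc
  have hDc : fderiv ℝ ψ x c = s • ψ x := by
    rw [hc, map_sum]
    simp only [map_smul]
    have := sum_colDet_update_smul V (ψ x)
    rw [colDet_map, hdet] at this
    exact this
  have hxc : inner ℝ x c = s * sympB n (ψ x) (fderiv ℝ ψ x (stdJ n x)) := by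
    rw [real_inner_comm, ← sympB_stdJ, ← hsymp, hDc, map_smul]
    rfl
  rw [hxc]
  ring

theorem exists_radial_cutoff {a ρ : ℝ} (ha : 0 < a) (haρ : a < ρ) :
    ∃ κ : ℝ → ℝ, ContDiff ℝ ∞ κ ∧ (∀ t ≤ a ^ 2, κ t = 1) ∧ (∀ t, ρ ^ 2 ≤ t → κ t = 0) ∧
      ∀ t, deriv κ t ≠ 0 → a ^ 2 ≤ t ∧ t ≤ ρ ^ 2 := by
  have hd : 0 < ρ ^ 2 - a ^ 2 := by nlinarith
  set κ : ℝ → ℝ := fun t => smoothTransition ((ρ ^ 2 - t) / (ρ ^ 2 - a ^ 2)) with hκd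
  have hκ : ContDiff ℝ ∞ κ :=
    smoothTransition.contDiff.comp ((contDiff_const.sub contDiff_id).div_const _)
  have hκ1 : ∀ t ≤ a ^ 2, κ t = 1 := fun t ht =>
    smoothTransition.one_of_one_le (by rw [le_div_iff₀ hd]; linarith)
  have hκ0 : ∀ t, ρ ^ 2 ≤ t → κ t = 0 := fun t ht =>
    smoothTransition.zero_of_nonpos (div_nonpos_of_nonpos_of_nonneg (by linarith) hd.le)
  refine ⟨κ, hκ, hκ1, hκ0, fun t ht => ?_⟩
  constructor
  · by_contra! h
    refine ht ?_
    have : κ =ᶠ[𝓝 t] fun _ => 1 := by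
      filter_upwards [Iio_mem_nhds h] with y hy using hκ1 y (le_of_lt hy)
    rw [this.deriv_eq, deriv_const]
  · by_contra! h
    refine ht ?_
    have : κ =ᶠ[𝓝 t] fun _ => 0 := by
      filter_upwards [Ioi_mem_nhds h] with y hy using hκ0 y (le_of_lt hy)
    rw [this.deriv_eq, deriv_const]

theorem continuous_sympB_fderiv {ψ : R2n n → R2n n} (hψ : ContDiff ℝ ∞ ψ) :
    Continuous fun x => sympB n (ψ x) (fderiv ℝ ψ x (stdJ n x)) := by
  have h1 : Continuous fun x => fderiv ℝ ψ x (stdJ n x) :=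
    (hψ.continuous_fderiv (by simp)).clm_apply (stdJ n).continuous
  have h2 : Continuous fun x => sympB n (ψ x) := (sympB n).continuous.comp hψ.continuous
  exact h2.clm_apply h1

theorem continuous_sympB_stdJ_self : Continuous fun x : R2n n => sympB n x (stdJ n x) :=
  (sympB n).continuous.clm_apply (stdJ n).continuous

theorem integral_radial_mul_sub_eq_zero {P Q : R2n n → ℝ} (hP : Continuous P)
    (hQ : Continuous Q) {k : ℝ → ℝ} (hk : Continuous k)
    (hcs : HasCompactSupport fun x : R2n n => k ‖x‖ * (P x - Q x))
    (h : ∀ x : R2n n, k ‖x‖ ≠ 0 →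
      ∫ t in (0 : ℝ)..2 * π, P (hopf n t x) = ∫ t in (0 : ℝ)..2 * π, Q (hopf n t x)) :
    ∫ x : R2n n, k ‖x‖ * (P x - Q x) = 0 := by
  have hh : ∀ x : R2n n, Continuous fun t => hopf n t x := fun x =>
    (continuous_cos.smul continuous_const).add (continuous_sin.smul continuous_const)
  refine integral_eq_zero_of_hopf ((hk.comp continuous_norm).mul (hP.sub hQ)) hcs fun x => ?_
  simp only [norm_hopf, intervalIntegral.integral_const_mul]
  by_cases h0 : k ‖x‖ = 0
  · rw [h0, zero_mul]
  have hPh : Continuous fun t => P (hopf n t x) := hP.comp (hh x)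
  have hQh : Continuous fun t => Q (hopf n t x) := hQ.comp (hh x)
  rw [intervalIntegral.integral_sub (hPh.intervalIntegrable _ _)
    (hQh.intervalIntegrable _ _), h x h0, sub_self, mul_zero]

theorem integral_cutoff_add_flux_id_eq_zero {κ : ℝ → ℝ} (hκ : ContDiff ℝ ∞ κ) {ρ : ℝ}
    (hρ : 0 ≤ ρ) (hκ0 : ∀ t, ρ ^ 2 < t → κ t = 0) :
    ∫ x : R2n n, ((2 * n : ℕ) * κ (‖x‖ ^ 2) +
      2 * (deriv κ (‖x‖ ^ 2) * sympB n x (stdJ n x))) = 0 := by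
  have h2 := integral_cutoff_det_add_flux_eq_zero (n := n) (ψ := id) contDiff_id hκ hρ hκ0
    (s := 1) fun x _ => by
      rw [fderiv_id]
      exact ⟨LinearMap.det_id, fun v w => rfl⟩
  have hid : (ContinuousLinearMap.id ℝ (R2n n)).det = 1 := LinearMap.det_id
  simp only [fderiv_id, hid, id, ContinuousLinearMap.id_apply, mul_one] at h2
  exact h2

/-- The signed volume enclosed by the image of a sphere under a symplectic map. -/
theorem setIntegral_ball_det_eq (hn : 2 ≤ n) {ψ : R2n n → R2n n} (hψ : ContDiff ℝ ∞ ψ)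
    {a ρ b s : ℝ} (ha : 0 ≤ a) (haρ : a < ρ) (hρb : ρ < b)
    (hs : ∀ x : R2n n, a < ‖x‖ → ‖x‖ < b → (fderiv ℝ ψ x).det = s ∧
      ∀ v w, sympB n (fderiv ℝ ψ x v) (fderiv ℝ ψ x w) = sympB n v w) :
    ∫ x in ball (0 : R2n n) ρ, (fderiv ℝ ψ x).det = s * volume.real (ball (0 : R2n n) ρ) := by
  obtain ⟨a', haa', ha'ρ⟩ := exists_between haρ
  have ha'0 : 0 < a' := ha.trans_lt haa'
  have hρ0 : 0 < ρ := ha'0.trans ha'ρ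
  obtain ⟨κ, hκ, hκ1, hκ0, hdκ⟩ := exists_radial_cutoff ha'0 ha'ρ
  have hshell : ∀ x : R2n n, deriv κ (‖x‖ ^ 2) ≠ 0 → a < ‖x‖ ∧ ‖x‖ < b := fun x hx => by
    obtain ⟨h1, h2⟩ := hdκ _ hx
    have h3 := (pow_le_pow_iff_left₀ ha'0.le (norm_nonneg x) two_ne_zero).1 h1
    have h4 := (pow_le_pow_iff_left₀ (norm_nonneg x) hρ0.le two_ne_zero).1 h2
    exact ⟨haa'.trans_le h3, h4.trans_lt hρb⟩
  have hns : Continuous fun x : R2n n => ‖x‖ ^ 2 := by fun_prop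
  have hκ'c : Continuous fun x : R2n n => deriv κ (‖x‖ ^ 2) :=
    (hκ.continuous_deriv (by simp)).comp hns
  have hκ'0 : ∀ t, ρ ^ 2 < t → deriv κ t = 0 := fun t ht => by
    by_contra h
    exact absurd (hdκ t h).2 (not_le.2 ht)
  set P : R2n n → ℝ := fun x => sympB n (ψ x) (fderiv ℝ ψ x (stdJ n x)) with hP
  set Q : R2n n → ℝ := fun x => sympB n x (stdJ n x) with hQ
  have hPc : Continuous P := continuous_sympB_fderiv hψ
  have hQc : Continuous Q := continuous_sympB_stdJ_self
  have hcs : ∀ k : R2n n → ℝ, HasCompactSupport fun x => deriv κ (‖x‖ ^ 2) * k x :=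
    fun k => hasCompactSupport_of_norm_sq hρ0.le fun x hx => by rw [hκ'0 _ hx, zero_mul]
  have hcs' : ∀ k : R2n n → ℝ, HasCompactSupport fun x => κ (‖x‖ ^ 2) * k x :=
    fun k => hasCompactSupport_of_norm_sq hρ0.le fun x hx => by rw [hκ0 _ hx.le, zero_mul]
  have hκc : Continuous fun x : R2n n => κ (‖x‖ ^ 2) := hκ.continuous.comp hns
  have hdetc := continuous_det_fderiv hψ
  have hzero : ∫ x : R2n n, deriv κ (‖x‖ ^ 2) * (P x - Q x) = 0 :=
    integral_radial_mul_sub_eq_zero (k := fun y => deriv κ (y ^ 2)) hPc hQc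
      ((hκ.continuous_deriv (by simp)).comp (continuous_pow 2)) (hcs _) fun x hx =>
        integral_sympB_hopf_eq hn hψ x fun y hy =>
          (hs y (by rw [hy]; exact (hshell x hx).1) (by rw [hy]; exact (hshell x hx).2)).2
  have h1 := integral_cutoff_det_add_flux_eq_zero hψ hκ hρ0.le (fun t ht => hκ0 t ht.le)
    (s := s) fun x hx => hs x (hshell x hx).1 (hshell x hx).2
  have h2 := integral_cutoff_add_flux_id_eq_zero (n := n) hκ hρ0.le fun t ht => hκ0 t ht.le
  have i1 : Integrable fun x => κ (‖x‖ ^ 2) * (fderiv ℝ ψ x).det :=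
    (hκc.mul hdetc).integrable_of_hasCompactSupport (hcs' _)
  have i2 : Integrable fun x : R2n n => κ (‖x‖ ^ 2) :=
    hκc.integrable_of_hasCompactSupport (by simpa using hcs' fun _ => 1)
  have i3 : Integrable fun x => deriv κ (‖x‖ ^ 2) * P x :=
    (hκ'c.mul hPc).integrable_of_hasCompactSupport (hcs _)
  have i4 : Integrable fun x => deriv κ (‖x‖ ^ 2) * Q x :=
    (hκ'c.mul hQc).integrable_of_hasCompactSupport (hcs _)
  rw [integral_add (i1.const_mul _) (i3.const_mul _), integral_const_mul,
    integral_const_mul] at h1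
  rw [integral_add (i2.const_mul _) (i4.const_mul _), integral_const_mul,
    integral_const_mul] at h2
  simp only [mul_sub] at hzero
  rw [integral_sub i3 i4] at hzero
  have hcut : ∫ x, κ (‖x‖ ^ 2) * (fderiv ℝ ψ x).det = s * ∫ x : R2n n, κ (‖x‖ ^ 2) := by
    have hm : ((2 * n : ℕ) : ℝ) ≠ 0 := by
      have : 2 * n ≠ 0 := by omega
      exact_mod_cast this
    refine mul_left_cancel₀ hm ?_
    linear_combination h1 - s * h2 - 2 * s * hzero
  have hfin : ∫ x in ball (0 : R2n n) ρ, ((fderiv ℝ ψ x).det - s) =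
      ∫ x, (κ (‖x‖ ^ 2) * (fderiv ℝ ψ x).det - s * κ (‖x‖ ^ 2)) := by
    rw [← integral_indicator measurableSet_ball]
    refine integral_congr_ae (Eventually.of_forall fun x => ?_)
    simp only
    by_cases hx : a' ≤ ‖x‖
    · by_cases hxρ : ‖x‖ < ρ
      · rw [indicator_of_mem (mem_ball_zero_iff.2 hxρ),
          (hs x (haa'.trans_le hx) (hxρ.trans hρb)).1]
        ring
      · rw [indicator_of_notMem (by simpa using hxρ), hκ0 _ (by
          rw [not_lt] at hxρ
          gcongr)]
        simp
    · rw [not_le] at hx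
      rw [indicator_of_mem (mem_ball_zero_iff.2 (hx.trans ha'ρ)), hκ1 _ (by gcongr)]
      ring
  rw [integral_sub i1 (i2.const_mul s), integral_const_mul, hcut, sub_self,
    integral_sub ((hdetc.continuousOn.integrableOn_compact
      (isCompact_closedBall (0 : R2n n) ρ)).mono_set ball_subset_closedBall)
      (integrableOn_const measure_ball_lt_top.ne), setIntegral_const, smul_eq_mul] at hfin
  linarith

end HopfAveraging

section Components

variable {E : Type*} [NormedAddCommGroup E] [NormedSpace ℝ E]

theorem isPreconnected_setOf_norm_mem (hE : 1 < Module.rank ℝ E) {I : Set ℝ}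
    (hI : IsPreconnected I) (hpos : ∀ t ∈ I, 0 < t) : IsPreconnected {x : E | ‖x‖ ∈ I} := by
  have h := (hI.prod (isPreconnected_sphere hE (0 : E) 1)).image (fun p : ℝ × E => p.1 • p.2)
    (continuous_fst.smul continuous_snd).continuousOn
  convert h using 1
  ext x
  constructor
  · intro hx
    have h0 := hpos _ hx
    refine ⟨(‖x‖, ‖x‖⁻¹ • x), ⟨hx, ?_⟩, ?_⟩
    · rw [mem_sphere_zero_iff_norm, norm_smul, norm_inv, norm_norm, inv_mul_cancel₀ h0.ne']
    · simp only [smul_smul, mul_inv_cancel₀ h0.ne', one_smul]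
  · rintro ⟨⟨t, u⟩, ⟨ht, hu⟩, rfl⟩
    rw [mem_sphere_zero_iff_norm] at hu
    have h0 := hpos t ht
    rw [mem_ofPred_eq, norm_smul, hu, mul_one, norm_of_nonneg h0.le]
    exact ht

variable {X : Type*} [TopologicalSpace X] [PreconnectedSpace X] [LocallyConnectedSpace X]

/-- If a closed set `K` has a neighbourhood `I ∪ K ∪ O` with `I` and `O` connected and disjoint
from `K`, then every component of the complement of `K` contains `I` or `O`. -/
theorem subset_connectedComponentIn_or {K I O : Set X} (hK : IsClosed K) (hne : K.Nonempty)
    (hnhds : ∀ z ∈ K, I ∪ K ∪ O ∈ 𝓝 z) (hI : IsPreconnected I) (hO : IsPreconnected O)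
    (hIK : I ⊆ Kᶜ) (hOK : O ⊆ Kᶜ) {y : X} (hy : y ∈ Kᶜ) :
    I ⊆ connectedComponentIn Kᶜ y ∨ O ⊆ connectedComponentIn Kᶜ y := by
  have hCo : ∀ z, IsOpen (connectedComponentIn Kᶜ z) := fun z =>
    hK.isOpen_compl.connectedComponentIn
  have hCne : connectedComponentIn Kᶜ y ≠ univ := fun h => by
    obtain ⟨k, hk⟩ := hne
    exact connectedComponentIn_subset Kᶜ y (h ▸ mem_univ k) hk
  have hncl : ¬ IsClosed (connectedComponentIn Kᶜ y) := fun h => by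
    rcases isClopen_iff.1 ⟨h, hCo y⟩ with h | h
    · exact (h ▸ mem_connectedComponentIn hy : y ∈ (∅ : Set X))
    · exact hCne h
  obtain ⟨z, hz, hzn⟩ : ∃ z ∈ closure (connectedComponentIn Kᶜ y),
      z ∉ connectedComponentIn Kᶜ y := by
    by_contra! h
    exact hncl (isClosed_of_closure_subset h)
  have hzK : z ∈ K := by
    by_contra hzK
    obtain ⟨w, hw, hwy⟩ := mem_closure_iff.1 hz _ (hCo z) (mem_connectedComponentIn hzK)
    refine hzn ?_
    rw [connectedComponentIn_eq hwy, ← connectedComponentIn_eq hw]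
    exact mem_connectedComponentIn hzK
  obtain ⟨w, hw, hwy⟩ := mem_closure_iff_nhds.1 hz _ (hnhds z hzK)
  rw [connectedComponentIn_eq hwy]
  rcases hw with (hw | hw) | hw
  · exact Or.inl (hI.subset_connectedComponentIn hw hIK)
  · exact absurd hw (connectedComponentIn_subset _ _ hwy)
  · exact Or.inr (hO.subset_connectedComponentIn hw hOK)

theorem connectedComponentIn_eq_or_eq {K I O : Set X} (hK : IsClosed K) (hne : K.Nonempty)
    (hnhds : ∀ z ∈ K, I ∪ K ∪ O ∈ 𝓝 z) (hI : IsConnected I) (hO : IsConnected O)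
    (hIK : I ⊆ Kᶜ) (hOK : O ⊆ Kᶜ) {p q y : X} (hp : p ∈ Kᶜ) (hq : q ∈ Kᶜ) (hy : y ∈ Kᶜ)
    (hpq : connectedComponentIn Kᶜ p ≠ connectedComponentIn Kᶜ q) :
    connectedComponentIn Kᶜ y = connectedComponentIn Kᶜ p ∨
      connectedComponentIn Kᶜ y = connectedComponentIn Kᶜ q := by
  have key : ∀ {S : Set X} {u v : X}, S.Nonempty → S ⊆ connectedComponentIn Kᶜ u →
      S ⊆ connectedComponentIn Kᶜ v → connectedComponentIn Kᶜ u = connectedComponentIn Kᶜ v := by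
    rintro S u v ⟨w, hw⟩ hu hv
    rw [connectedComponentIn_eq (hu hw), connectedComponentIn_eq (hv hw)]
  have h : ∀ {y}, y ∈ Kᶜ → I ⊆ connectedComponentIn Kᶜ y ∨ O ⊆ connectedComponentIn Kᶜ y :=
    fun hy => subset_connectedComponentIn_or hK hne hnhds hI.2 hO.2 hIK hOK hy
  rcases h hp with h1 | h1 <;> rcases h hq with h2 | h2 <;> rcases h hy with h3 | h3
  · exact Or.inl (key hI.1 h3 h1)
  · exact absurd (key hI.1 h1 h2) hpq
  · exact Or.inl (key hI.1 h3 h1)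
  · exact Or.inr (key hO.1 h3 h2)
  · exact Or.inr (key hI.1 h3 h2)
  · exact Or.inl (key hO.1 h3 h1)
  · exact absurd (key hO.1 h1 h2) hpq
  · exact Or.inl (key hO.1 h3 h1)

end Components

/-- A smooth map which restricts to a symplectic embedding of the open shell `a < ‖x‖ < b`,
with Jacobian determinant equal to `s` there. -/
structure IsSympShell (n : ℕ) (a b s : ℝ) (ψ : R2n n → R2n n) : Prop where
  contDiff : ContDiff ℝ ∞ ψ
  injOn : InjOn ψ {x | ‖x‖ ∈ Ioo a b}
  det_eq : ∀ x : R2n n, ‖x‖ ∈ Ioo a b → (fderiv ℝ ψ x).det = s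
  symp : ∀ x : R2n n, ‖x‖ ∈ Ioo a b →
    ∀ v w, sympB n (fderiv ℝ ψ x v) (fderiv ℝ ψ x w) = sympB n v w
  abs_eq_one : |s| = 1

section SympShell

variable {n : ℕ} {a b s σ : ℝ} {ψ : R2n n → R2n n}

theorem one_lt_rank_R2n (hn : 2 ≤ n) : 1 < Module.rank ℝ (R2n n) := by
  rw [← Module.finrank_eq_rank, finrank_euclideanSpace_fin]
  have : 1 < 2 * n := by omega
  exact_mod_cast this

theorem IsSympShell.image_mem_nhds (h : IsSympShell n a b s ψ) {x : R2n n}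
    (hx : ‖x‖ ∈ Ioo a b) {S : Set (R2n n)} (hS : S ∈ 𝓝 x) : ψ '' S ∈ 𝓝 (ψ x) := by
  have hs : (fderiv ℝ ψ x).det ≠ 0 := by
    rw [h.det_eq x hx]
    intro h0
    have := h.abs_eq_one
    rw [h0, abs_zero] at this
    exact zero_ne_one this
  have hst : HasStrictFDerivAt ψ (((fderiv ℝ ψ x).toContinuousLinearEquivOfDetNeZero hs :
      R2n n ≃L[ℝ] R2n n) : R2n n →L[ℝ] R2n n) x := by
    rw [ContinuousLinearMap.coe_toContinuousLinearEquivOfDetNeZero]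
    exact h.contDiff.contDiffAt.hasStrictFDerivAt (by simp)
  rw [← hst.map_nhds_eq_of_equiv]
  exact image_mem_map hS

theorem isConnected_setOf_norm_mem (hn : 2 ≤ n) {I : Set ℝ} (hI : IsConnected I)
    (hpos : ∀ t ∈ I, 0 < t) : IsConnected {x : R2n n | ‖x‖ ∈ I} := by
  refine ⟨?_, isPreconnected_setOf_norm_mem (one_lt_rank_R2n hn) hI.2 hpos⟩
  obtain ⟨t, ht⟩ := hI.1
  have : Nontrivial (R2n n) := Module.nontrivial_of_finrank_pos (R := ℝ) (by
    rw [finrank_euclideanSpace_fin]; omega)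
  obtain ⟨x, hx⟩ := exists_norm_eq (R2n n) (hpos t ht).le
  exact ⟨x, by rw [mem_ofPred_eq, hx]; exact ht⟩

theorem IsSympShell.connectedComponentIn_eq_or_eq (hn : 2 ≤ n) (h : IsSympShell n a b s ψ)
    (ha : 0 ≤ a) (hσ : σ ∈ Ioo a b) {p q y : R2n n} (hp : p ∈ (ψ '' sphere 0 σ)ᶜ)
    (hq : q ∈ (ψ '' sphere 0 σ)ᶜ) (hy : y ∈ (ψ '' sphere 0 σ)ᶜ)
    (hpq : connectedComponentIn (ψ '' sphere 0 σ)ᶜ p ≠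
      connectedComponentIn (ψ '' sphere 0 σ)ᶜ q) :
    connectedComponentIn (ψ '' sphere 0 σ)ᶜ y = connectedComponentIn (ψ '' sphere 0 σ)ᶜ p ∨
      connectedComponentIn (ψ '' sphere 0 σ)ᶜ y =
        connectedComponentIn (ψ '' sphere 0 σ)ᶜ q := by
  have hc := h.contDiff.continuous
  have hσ0 : 0 < σ := ha.trans_lt hσ.1
  have hconn : ∀ {I : Set ℝ}, IsConnected I → (∀ t ∈ I, 0 < t) →
      IsConnected (ψ '' {x : R2n n | ‖x‖ ∈ I}) := fun hI hpos =>
    (isConnected_setOf_norm_mem hn hI hpos).image _ hc.continuousOn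
  have hdisj : ∀ {I : Set ℝ}, I ⊆ Ioo a b → σ ∉ I →
      ψ '' {x : R2n n | ‖x‖ ∈ I} ⊆ (ψ '' sphere 0 σ)ᶜ := by
    rintro I hI hσI _ ⟨x, hx, rfl⟩ ⟨z, hz, hzx⟩
    rw [mem_sphere_zero_iff_norm] at hz
    have := h.injOn (by rw [mem_ofPred_eq, hz]; exact hσ) (hI hx) hzx
    rw [← this, mem_ofPred_eq, hz] at hx
    exact hσI hx
  refine _root_.connectedComponentIn_eq_or_eq (I := ψ '' {x : R2n n | ‖x‖ ∈ Ioo a σ})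
    (O := ψ '' {x : R2n n | ‖x‖ ∈ Ioo σ b}) ((isCompact_sphere 0 σ).image hc).isClosed ?_ ?_
    (hconn (isConnected_Ioo hσ.1) fun t ht => ha.trans_lt ht.1)
    (hconn (isConnected_Ioo hσ.2) fun t ht => hσ0.trans ht.1)
    (hdisj (Ioo_subset_Ioo_right hσ.2.le) fun h => lt_irrefl _ h.2)
    (hdisj (Ioo_subset_Ioo_left hσ.1.le) fun h => lt_irrefl _ h.1) hp hq hy hpq
  · obtain ⟨x, hx⟩ := (isConnected_setOf_norm_mem hn (isConnected_singleton (x := σ))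
      fun t ht => (mem_singleton_iff.1 ht) ▸ hσ0).1
    exact ⟨ψ x, x, mem_sphere_zero_iff_norm.2 hx, rfl⟩
  · rintro _ ⟨x, hx, rfl⟩
    rw [mem_sphere_zero_iff_norm] at hx
    have hmem : {x : R2n n | ‖x‖ ∈ Ioo a b} ∈ 𝓝 x :=
      (isOpen_Ioo.preimage continuous_norm).mem_nhds (by rw [mem_preimage, hx]; exact hσ)
    refine mem_of_superset (h.image_mem_nhds (hx ▸ hσ) hmem) ?_
    rintro _ ⟨z, hz, rfl⟩
    rcases lt_trichotomy ‖z‖ σ with hlt | heq | hgt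
    · exact Or.inl (Or.inl ⟨z, ⟨hz.1, hlt⟩, rfl⟩)
    · exact Or.inl (Or.inr ⟨z, mem_sphere_zero_iff_norm.2 heq, rfl⟩)
    · exact Or.inr ⟨z, ⟨hgt, hz.2⟩, rfl⟩

theorem IsSympShell.hasLocalValue_eq_or_eq (hn : 2 ≤ n) (h : IsSympShell n a b s ψ)
    (ha : 0 ≤ a) (hσ : σ ∈ Ioo a b) {g : R2n n → ℝ}
    (hg : ∀ y ∈ (ψ '' sphere 0 σ)ᶜ, ∃ c, HasLocalValue g y c) {p q y : R2n n} {c c' d : ℝ}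
    (hp : p ∈ (ψ '' sphere 0 σ)ᶜ) (hq : q ∈ (ψ '' sphere 0 σ)ᶜ) (hy : y ∈ (ψ '' sphere 0 σ)ᶜ)
    (hpc : HasLocalValue g p c) (hqc : HasLocalValue g q c') (hyd : HasLocalValue g y d)
    (hcc : c ≠ c') : d = c ∨ d = c' := by
  have key : ∀ {u v : R2n n} {e e' : ℝ}, u ∈ (ψ '' sphere 0 σ)ᶜ → v ∈ (ψ '' sphere 0 σ)ᶜ →
      HasLocalValue g u e → HasLocalValue g v e' →
      connectedComponentIn (ψ '' sphere 0 σ)ᶜ u = connectedComponentIn (ψ '' sphere 0 σ)ᶜ v →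
      e = e' := fun {u v e e'} hu hv he he' huv =>
    (HasLocalValue.of_isPreconnected isPreconnected_connectedComponentIn
      (fun y hy => hg y (connectedComponentIn_subset _ _ hy)) (mem_connectedComponentIn hu)
      (huv ▸ mem_connectedComponentIn hv) he).unique he'
  rcases h.connectedComponentIn_eq_or_eq hn ha hσ hp hq hy
    fun hpq => hcc (key hp hq hpc hqc hpq) with h1 | h1
  · exact Or.inl (key hy hp hyd hpc h1)
  · exact Or.inr (key hy hq hyd hqc h1)

end SympShell

section ShellVolume

variable {n : ℕ} {a b s ρ r : ℝ} {ψ : R2n n → R2n n}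

theorem le_of_volume_real_closedBall_le (hn : 2 ≤ n) {t u : ℝ} (hu : 0 ≤ u)
    (h : volume.real (closedBall (0 : R2n n) t) ≤ volume.real (closedBall (0 : R2n n) u)) :
    t ≤ u := by
  by_contra! hut
  rw [Measure.addHaar_real_closedBall _ _ hu, Measure.addHaar_real_closedBall _ _ (hu.trans hut.le)]
    at h
  have h1 : 0 < volume.real (ball (0 : R2n n) 1) :=
    ENNReal.toReal_pos (measure_ball_pos _ _ one_pos).ne' measure_ball_lt_top.ne
  have h2 := le_of_mul_le_mul_right h h1
  rw [finrank_euclideanSpace_fin] at h2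
  exact absurd h2 (not_le.2 (pow_lt_pow_left₀ hut hu (by omega)))

theorem volume_real_closedBall_eq_ball (hn : 2 ≤ n) (t : ℝ) :
    volume.real (closedBall (0 : R2n n) t) = volume.real (ball (0 : R2n n) t) := by
  have : Nontrivial (R2n n) := Module.nontrivial_of_finrank_pos (R := ℝ) (by
    rw [finrank_euclideanSpace_fin]; omega)
  rw [measureReal_def, measureReal_def, Measure.addHaar_closedBall_eq_addHaar_ball]

theorem IsSympShell.volume_image_sphere_eq_zero (hn : 2 ≤ n) (h : IsSympShell n a b s ψ)
    (σ : ℝ) : volume (ψ '' sphere 0 σ) = 0 := by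
  have : Nontrivial (R2n n) := Module.nontrivial_of_finrank_pos (R := ℝ) (by
    rw [finrank_euclideanSpace_fin]; omega)
  exact addHaar_image_eq_zero_of_differentiableOn_of_addHaar_eq_zero _
    (h.contDiff.differentiable (by simp)).differentiableOn (Measure.addHaar_sphere _ _ _)

/-- The mapping degree density of the ball of radius `σ`. -/
theorem IsSympShell.exists_degree (hn : 2 ≤ n) (h : IsSympShell n a b s ψ) (ha : 0 ≤ a)
    {σ : ℝ} (hσ : σ ∈ Ioo a b) :
    ∃ g : R2n n → ℝ, Integrable g ∧
      (∀ f : R2n n → ℝ, StronglyMeasurable f → (∃ C, ∀ x, ‖f x‖ ≤ C) →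
        ∫ x in ball 0 σ, (fderiv ℝ ψ x).det * f (ψ x) = ∫ x, g x * f x) ∧
      (∀ y ∈ (ψ '' sphere 0 σ)ᶜ, ∃ c, HasLocalValue g y c) ∧
      (∀ y ∈ (ψ '' closedBall 0 σ)ᶜ, HasLocalValue g y 0) ∧
      ∫ x, g x = s * volume.real (ball (0 : R2n n) σ) := by
  obtain ⟨g, hg, hd⟩ := exists_density h.contDiff (isBounded_ball (x := (0 : R2n n)) (r := σ))
  refine ⟨g, hg, hd, fun y hy => ?_, fun y hy => ?_, ?_⟩
  · refine exists_hasLocalValue_density h.contDiff isOpen_ball isBounded_ball hg hd ?_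
    rw [frontier_ball _ (ha.trans_lt hσ.1).ne']
    exact hy
  · exact hasLocalValue_zero_of_notMem
      ((isCompact_closedBall 0 σ).image h.contDiff.continuous).isClosed
      (fun x hx => ⟨x, ball_subset_closedBall hx, rfl⟩) hg hd hy
  · have h1 := hd (fun _ => 1) stronglyMeasurable_const ⟨1, fun _ => by simp⟩
    simp only [mul_one] at h1
    rw [← h1]
    exact setIntegral_ball_det_eq hn h.contDiff ha hσ.1 hσ.2
      fun x hx hx' => ⟨h.det_eq x ⟨hx, hx'⟩, h.symp x ⟨hx, hx'⟩⟩

theorem IsSympShell.radius_bounds (hn : 2 ≤ n) (h : IsSympShell n a b s ψ) (ha : 0 ≤ a)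
    (haρ : a < ρ) (hρr : ρ < r) (hrb : r < b) {e : ℝ} (he : 0 < e)
    (hmap : ∀ x, ‖x‖ ∈ Icc ρ r → ψ x ∈ ball (0 : R2n n) 1 \ closedBall 0 e)
    {D : Set (R2n n)} {x₀ : R2n n}
    (hD : D = connectedComponentIn (ψ '' sphere (0 : R2n n) ρ)ᶜ x₀) (hbd : IsBounded D)
    (hcontain : closedBall (0 : R2n n) e ⊆ D) : e < ρ ∧ r < 1 := by
  have hc := h.contDiff.continuous
  have hρ0 : 0 < ρ := ha.trans_lt haρ
  have hr0 : 0 < r := hρ0.trans hρr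
  have hρm : ρ ∈ Ioo a b := ⟨haρ, hρr.trans hrb⟩
  have hrm : r ∈ Ioo a b := ⟨haρ.trans hρr, hrb⟩
  have hs0 : s ≠ 0 := fun h0 => by
    have := h.abs_eq_one
    rw [h0, abs_zero] at this
    exact zero_ne_one this
  set T : Set (R2n n) := {x | ‖x‖ ∈ Icc ρ r} with hT
  have hTc : IsCompact T := by
    refine (isCompact_closedBall (0 : R2n n) r).of_isClosed_subset
      (isClosed_Icc.preimage continuous_norm) fun x hx => mem_closedBall_zero_iff.2 hx.2
  have hKρ : IsCompact (ψ '' sphere 0 ρ) := (isCompact_sphere 0 ρ).image hc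
  have hKr : IsCompact (ψ '' sphere 0 r) := (isCompact_sphere 0 r).image hc
  have hKρT : ψ '' sphere 0 ρ ⊆ ψ '' T := image_mono fun x hx => by
    rw [mem_sphere_zero_iff_norm] at hx
    exact ⟨hx.ge, hx.trans_le hρr.le⟩
  have hKrT : ψ '' sphere 0 r ⊆ ψ '' T := image_mono fun x hx => by
    rw [mem_sphere_zero_iff_norm] at hx
    exact ⟨hρr.le.trans hx.ge, hx.le⟩
  obtain ⟨η, hη1, hη⟩ := exists_lt_subset_ball (hTc.image hc).isClosed
    (show ψ '' T ⊆ ball 0 1 by rintro _ ⟨x, hx, rfl⟩; exact (hmap x hx).1)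
  have hTe : ∀ y ∈ ψ '' T, e < ‖y‖ := by
    rintro _ ⟨x, hx, rfl⟩
    simpa using (hmap x hx).2
  obtain ⟨x₁, hx₁⟩ := (isConnected_setOf_norm_mem hn (isConnected_Icc hρr.le)
    fun t ht => hρ0.trans_le ht.1).1
  have hη0 : 0 < η := he.trans ((hTe _ ⟨x₁, hx₁, rfl⟩).trans
    (mem_ball_zero_iff.1 (hη ⟨x₁, hx₁, rfl⟩)))
  -- the connected set of points far from the origin
  have hZ : IsConnected {y : R2n n | ‖y‖ ∈ Ici η} :=
    isConnected_setOf_norm_mem hn isConnected_Ici fun t ht => hη0.trans_le ht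
  have hZT : ∀ y : R2n n, η ≤ ‖y‖ → y ∉ ψ '' T := fun y hy hyT =>
    absurd (mem_ball_zero_iff.1 (hη hyT)) (not_lt.2 hy)
  obtain ⟨R, hR⟩ := (((isCompact_closedBall (0 : R2n n) r).image hc).isBounded.union
    hbd).subset_ball (0 : R2n n)
  obtain ⟨q, hq⟩ : ∃ q : R2n n, ‖q‖ = max R η := by
    have : Nontrivial (R2n n) := Module.nontrivial_of_finrank_pos (R := ℝ) (by
      rw [finrank_euclideanSpace_fin]; omega)
    exact exists_norm_eq _ (hη0.le.trans (le_max_right _ _))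
  have hqη : η ≤ ‖q‖ := hq ▸ le_max_right _ _
  have hqR : q ∉ ψ '' closedBall 0 r ∪ D := fun hmem =>
    absurd (mem_ball_zero_iff.1 (hR hmem)) (not_lt.2 (hq ▸ le_max_left _ _))
  have h0D : (0 : R2n n) ∈ D := hcontain (mem_closedBall_self he.le)
  have h0T : (0 : R2n n) ∉ ψ '' T := fun h0 => by simpa using he.trans (hTe _ h0)
  have hDeq : D = connectedComponentIn (ψ '' sphere (0 : R2n n) ρ)ᶜ 0 := by
    rw [hD] at h0D ⊢
    exact connectedComponentIn_eq h0D
  have hDK : D ⊆ (ψ '' sphere (0 : R2n n) ρ)ᶜ := hDeq ▸ connectedComponentIn_subset _ _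
  have hDo : IsOpen D := hDeq ▸ hKρ.isClosed.isOpen_compl.connectedComponentIn
  have h0ρ : (0 : R2n n) ∈ (ψ '' sphere 0 ρ)ᶜ := hDK h0D
  have hqρ : q ∈ (ψ '' sphere 0 ρ)ᶜ := fun hK => hZT q hqη (hKρT hK)
  have h0r : (0 : R2n n) ∈ (ψ '' sphere 0 r)ᶜ := fun hK => h0T (hKrT hK)
  have hqr : q ∈ (ψ '' sphere 0 r)ᶜ := fun hK => hZT q hqη (hKrT hK)
  have hDη : D ⊆ closedBall 0 η := fun y hy => by
    rw [mem_closedBall_zero_iff]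
    by_contra! hyη
    have hsub := hZ.2.subset_connectedComponentIn (F := (ψ '' sphere (0 : R2n n) ρ)ᶜ)
      (x := y) hyη.le fun z hz hzK => hZT z hz (hKρT hzK)
    rw [← connectedComponentIn_eq (hDeq ▸ hy), ← hDeq] at hsub
    exact hqR (Or.inr (hsub hqη))
  have hqD : connectedComponentIn (ψ '' sphere (0 : R2n n) ρ)ᶜ 0 ≠
      connectedComponentIn (ψ '' sphere (0 : R2n n) ρ)ᶜ q := fun heq => by
    rw [← hDeq] at heq
    exact hqR (Or.inr (heq ▸ mem_connectedComponentIn hqρ))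
  -- the degrees of the two balls
  obtain ⟨g, hg, hgd, hgl, hgf, hgi⟩ := h.exists_degree hn ha hρm
  obtain ⟨g', hg', hgd', hgl', hgf', -⟩ := h.exists_degree hn ha hrm
  obtain ⟨d, hd⟩ := hgl 0 h0ρ
  have hgq : HasLocalValue g q 0 := hgf q fun hK =>
    hqR (Or.inl (image_mono (closedBall_subset_closedBall hρr.le) hK))
  have hgq' : HasLocalValue g' q 0 := hgf' q fun hK => hqR (Or.inl hK)
  have hlv : ∀ {u v : R2n n} {c : ℝ}, u ∈ (ψ '' sphere 0 ρ)ᶜ → HasLocalValue g u c →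
      v ∈ connectedComponentIn (ψ '' sphere 0 ρ)ᶜ u → HasLocalValue g v c :=
    fun hu hc hv => HasLocalValue.of_isPreconnected isPreconnected_connectedComponentIn
      (fun y hy => hgl y (connectedComponentIn_subset _ _ hy)) (mem_connectedComponentIn hu)
      hv hc
  have hgD : ∀ y ∈ D, HasLocalValue g y d := fun y hy => hlv h0ρ hd (hDeq ▸ hy)
  have hcomp : ∀ {y}, y ∈ (ψ '' sphere 0 ρ)ᶜ → y ∉ D →
      y ∈ connectedComponentIn (ψ '' sphere 0 ρ)ᶜ q := fun {y} hy hyD => by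
    rcases h.connectedComponentIn_eq_or_eq hn ha hρm h0ρ hqρ hy hqD with h1 | h1
    · exact absurd (hDeq ▸ h1 ▸ mem_connectedComponentIn hy) hyD
    · exact h1 ▸ mem_connectedComponentIn hy
  have hgE : ∀ {y}, y ∈ (ψ '' sphere 0 ρ)ᶜ → y ∉ D → HasLocalValue g y 0 :=
    fun hy hyD => hlv hqρ hgq (hcomp hy hyD)
  have hDv : volume D ≠ ⊤ := hbd.measure_lt_top.ne
  have hgint : ∫ x, g x = d * volume.real D := by
    have hae : g =ᵐ[volume] D.indicator fun _ => d := by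
      filter_upwards [ae_eq_of_forall_hasLocalValue hgD,
        ae_eq_of_forall_hasLocalValue (U := (ψ '' sphere 0 ρ)ᶜ \ D) (c := 0)
          fun y hy => hgE hy.1 hy.2,
        measure_eq_zero_iff_ae_notMem.1 (h.volume_image_sphere_eq_zero hn ρ)] with y h1 h2 h3
      by_cases hy : y ∈ D
      · rw [indicator_of_mem hy, h1 hy]
      · rw [indicator_of_notMem hy, h2 ⟨h3, hy⟩]
    rw [integral_congr_ae hae, integral_indicator hDo.measurableSet, setIntegral_const,
      smul_eq_mul, mul_comm]
  have hvρ : 0 < volume.real (ball (0 : R2n n) ρ) :=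
    ENNReal.toReal_pos (measure_ball_pos _ _ hρ0).ne' measure_ball_lt_top.ne
  rw [hgi] at hgint
  have hd0 : d ≠ 0 := fun h0 => by
    rw [h0, zero_mul] at hgint
    exact (mul_ne_zero hs0 hvρ.ne') hgint
  -- comparison of the two degrees on the image of the shell
  set W := ψ '' (ball 0 r \ ball 0 ρ) with hW
  have hshell : (ball 0 r \ ball 0 ρ : Set (R2n n)) ⊆ {x | ‖x‖ ∈ Ioo a b} := fun x hx =>
    ⟨haρ.trans_le (by simpa using hx.2), (by simpa using hx.1 : ‖x‖ < r).trans hrb⟩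
  have hWT : W ⊆ ψ '' T := image_mono fun x hx =>
    ⟨by simpa using hx.2, (by simpa using hx.1 : ‖x‖ < r).le⟩
  have hgg := density_eq_add_indicator h.contDiff (ball_subset_ball hρr.le) measurableSet_ball
    measurableSet_ball isBounded_ball (h.injOn.mono hshell) h.abs_eq_one
    (fun x hx => h.det_eq x (hshell hx)) hg hg' hgd hgd'
  have hg0' : HasLocalValue g' 0 d := by
    obtain ⟨u, huo, h0u, hu⟩ := hd
    refine ⟨u \ ψ '' T, huo.sdiff (hTc.image hc).isClosed, ⟨h0u, h0T⟩, ?_⟩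
    filter_upwards [hu, hgg] with y h1 h2 hy
    rw [h2, indicator_of_notMem fun hyW => hy.2 (hWT hyW), add_zero, h1 hy.1]
  have hinn : ∀ x : R2n n, ‖x‖ ∈ Ioo ρ r → ψ x ∈ (ψ '' sphere 0 ρ)ᶜ ∧
      ψ x ∈ (ψ '' sphere 0 r)ᶜ := fun x hx => by
    have hxm : ‖x‖ ∈ Ioo a b := ⟨haρ.trans hx.1, hx.2.trans hrb⟩
    constructor <;> rintro ⟨z, hz, hzx⟩ <;> rw [mem_sphere_zero_iff_norm] at hz <;>
      rw [h.injOn (by rw [mem_ofPred_eq, hz]; assumption) hxm hzx] at hz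
    · exact hx.1.ne' hz
    · exact hx.2.ne hz
  have hgW : ∀ (x : R2n n) (c : ℝ), ‖x‖ ∈ Ioo ρ r → HasLocalValue g (ψ x) c →
      c + s = d ∨ c + s = 0 := fun x c hx hcx => by
    refine h.hasLocalValue_eq_or_eq hn ha hrm hgl' h0r hqr (hinn x hx).2 hg0' hgq' ?_ hd0
    obtain ⟨u, huo, hxu, hu⟩ := hcx
    have hWn : W ∈ 𝓝 (ψ x) := by
      refine h.image_mem_nhds ⟨haρ.trans hx.1, hx.2.trans hrb⟩ ?_
      refine mem_of_superset ((isOpen_Ioo.preimage continuous_norm).mem_nhds hx) fun z hz => ?_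
      exact ⟨mem_ball_zero_iff.2 hz.2, by simpa using hz.1.le⟩
    obtain ⟨v, hvW, hvo, hxv⟩ := _root_.mem_nhds_iff.1 hWn
    refine ⟨u ∩ v, huo.inter hvo, ⟨hxu, hxv⟩, ?_⟩
    filter_upwards [hu, hgg] with y h1 h2 hy
    rw [h2, indicator_of_mem (hvW hy.2), h1 hy.1]
  have hWD : ∀ x : R2n n, ‖x‖ ∈ Ioo ρ r → ψ x ∉ D := fun x hx hxD => by
    rcases hgW x d hx (hgD _ hxD) with h1 | h1
    · exact hs0 (by linarith)
    · have h2 : d = -s := by linarith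
      rw [h2, neg_mul, ← mul_neg] at hgint
      have := mul_left_cancel₀ hs0 hgint
      linarith [measureReal_nonneg (μ := volume) (s := D)]
  have hds : d = s := by
    obtain ⟨x, hx⟩ := (isConnected_setOf_norm_mem hn (isConnected_Ioo hρr)
      fun t ht => hρ0.trans ht.1).1
    rcases hgW x 0 hx (hgE (hinn x hx).1 (hWD x hx)) with h1 | h1
    · linarith
    · exact absurd (by linarith) hs0
  rw [hds] at hgint
  have hvol : volume.real (ball (0 : R2n n) ρ) = volume.real D := mul_left_cancel₀ hs0 hgint
  have hDW : Disjoint D W := by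
    rw [disjoint_right]
    rintro _ ⟨x, hx, rfl⟩ hxD
    have h1 : ρ ≤ ‖x‖ := by simpa using hx.2
    rcases h1.eq_or_lt with h2 | h2
    · exact hDK hxD ⟨x, mem_sphere_zero_iff_norm.2 h2.symm, rfl⟩
    · exact hWD x ⟨h2, by simpa using hx.1⟩ hxD
  have hWv : volume.real W = volume.real (ball (0 : R2n n) r) - volume.real (ball (0 : R2n n) ρ) := by
    rw [← measureReal_sdiff (ball_subset_ball hρr.le) measurableSet_ball, measureReal_def,
      measureReal_def, volume_image_of_injOn_of_abs_det_eq_one h.contDiff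
        (measurableSet_ball.diff measurableSet_ball) (h.injOn.mono hshell)
        fun x hx => by rw [h.det_eq x (hshell hx), h.abs_eq_one]]
  have hfin : volume (closedBall (0 : R2n n) η) ≠ ⊤ := measure_closedBall_lt_top.ne
  have hWη : W ⊆ closedBall 0 η := fun y hy => ball_subset_closedBall (hη (hWT hy))
  constructor
  · obtain ⟨θ, hθ, hθD⟩ := (isCompact_closedBall (0 : R2n n) e).exists_cthickening_subset_open
      hDo hcontain
    rw [cthickening_closedBall hθ.le he.le] at hθD
    have hle : volume.real (closedBall (0 : R2n n) (θ + e)) ≤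
        volume.real (closedBall (0 : R2n n) ρ) := by
      rw [volume_real_closedBall_eq_ball hn ρ, hvol]
      exact measureReal_mono hθD hDv
    linarith [le_of_volume_real_closedBall_le hn hρ0.le hle]
  · refine lt_of_le_of_lt (le_of_volume_real_closedBall_le hn hη0.le ?_) hη1
    calc volume.real (closedBall (0 : R2n n) r) = volume.real D + volume.real W := by
          rw [volume_real_closedBall_eq_ball hn r, hWv, ← hvol]
          ring
      _ = volume.real (W ∪ D) := by
          rw [measureReal_union hDW.symm hDo.measurableSet
            (measure_ne_top_of_subset hWη hfin) hDv, add_comm]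
      _ ≤ volume.real (closedBall (0 : R2n n) η) :=
          measureReal_mono (union_subset hWη hDη) hfin

end ShellVolume

section Extension

/-- A map which is smooth on a neighbourhood of a closed set agrees near that set with a globally
smooth map. -/
theorem exists_contDiff_eqOn_of_isClosed {E F : Type*} [NormedAddCommGroup E] [NormedSpace ℝ E]
    [FiniteDimensional ℝ E] [NormedAddCommGroup F] [NormedSpace ℝ F] {N T : Set E} {φ : E → F}
    (hN : IsOpen N) (hT : IsClosed T) (hTN : T ⊆ N) (hφ : ContDiffOn ℝ ∞ φ N) :
    ∃ (ψ : E → F) (M : Set E), ContDiff ℝ ∞ ψ ∧ IsOpen M ∧ T ⊆ M ∧ M ⊆ N ∧ EqOn ψ φ M := by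
  obtain ⟨χ, hχ0, hχ1, -⟩ := exists_contMDiffMap_zero_one_nhds_of_isClosed (n := ⊤)
    (modelWithCornersSelf ℝ E) hN.isClosed_compl hT (disjoint_compl_left_iff_subset.2 hTN)
  have hχ : ContDiff ℝ ∞ χ := χ.contMDiff.contDiff
  obtain ⟨U, hUo, hTU, hU⟩ := (eventually_nhdsSet_iff_exists).1 hχ1
  refine ⟨fun x => χ x • φ x, U ∩ N, ?_, hUo.inter hN, subset_inter hTU hTN,
    inter_subset_right, fun x hx => by simp only [hU x hx.1, one_smul]⟩
  rw [contDiff_iff_contDiffAt]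
  intro x
  by_cases hx : x ∈ N
  · exact hχ.contDiffAt.smul (hφ.contDiffAt (hN.mem_nhds hx))
  · have : (fun x => χ x • φ x) =ᶠ[𝓝 x] fun _ => 0 := by
      filter_upwards [eventually_nhdsSet_iff_forall.1 hχ0 x hx] with y hy
      rw [hy, zero_smul]
    exact contDiffAt_const.congr_of_eventuallyEq this

theorem exists_setOf_norm_mem_Ioo_subset {E : Type*} [NormedAddCommGroup E] [ProperSpace E]
    {M : Set E} (hM : IsOpen M) {ρ r : ℝ} (hρ : 0 < ρ) (hρr : ρ ≤ r)
    (h : {x : E | ‖x‖ ∈ Icc ρ r} ⊆ M) :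
    ∃ a b, 0 ≤ a ∧ a < ρ ∧ r < b ∧ {x : E | ‖x‖ ∈ Ioo a b} ⊆ M := by
  have hC : IsClosed (norm '' (Mᶜ ∩ closedBall (0 : E) (r + 1))) :=
    (((isCompact_closedBall 0 (r + 1)).inter_left hM.isClosed_compl).image
      continuous_norm).isClosed
  have hnot : ∀ t ∈ Icc ρ r, t ∉ norm '' (Mᶜ ∩ closedBall (0 : E) (r + 1)) := by
    rintro _ ht ⟨x, hx, rfl⟩
    exact hx.1 (h ht)
  obtain ⟨a, haρ, ha⟩ := exists_Ioc_subset_of_mem_nhds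
    (hC.isOpen_compl.mem_nhds (hnot ρ ⟨le_rfl, hρr⟩)) ⟨0, hρ⟩
  obtain ⟨b, hrb, hb⟩ := exists_Ico_subset_of_mem_nhds
    (hC.isOpen_compl.mem_nhds (hnot r ⟨hρr, le_rfl⟩)) ⟨r + 1, by linarith⟩
  refine ⟨max a 0, min b (r + 1), le_max_right _ _, max_lt haρ hρ,
    lt_min hrb (by linarith), fun x hx => ?_⟩
  by_contra hxM
  have hx1 := hx.2.trans_le (min_le_right _ _)
  have hx2 := (le_max_left _ _).trans_lt hx.1
  have hx3 := hx.2.trans_le (min_le_left _ _)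
  have hmem : ‖x‖ ∈ norm '' (Mᶜ ∩ closedBall (0 : E) (r + 1)) :=
    ⟨x, ⟨hxM, mem_closedBall_zero_iff.2 hx1.le⟩, rfl⟩
  rcases le_total ‖x‖ ρ with h1 | h1
  · exact ha ⟨hx2, h1⟩ hmem
  · rcases le_total ‖x‖ r with h2 | h2
    · exact hnot _ ⟨h1, h2⟩ hmem
    · exact hb ⟨h2, hx3⟩ hmem

variable {n : ℕ}

theorem IsSympEmbOn.exists_isSympShell (hn : 2 ≤ n) {N U : Set (R2n n)} {φ : R2n n → R2n n}
    (hφ : IsSympEmbOn n N U φ) {ρ r : ℝ} (hρ : 0 < ρ) (hρr : ρ ≤ r)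
    (hN : {x : R2n n | ‖x‖ ∈ Icc ρ r} ⊆ N) :
    ∃ a b s ψ, 0 ≤ a ∧ a < ρ ∧ r < b ∧ IsSympShell n a b s ψ ∧
      EqOn ψ φ {x | ‖x‖ ∈ Icc ρ r} := by
  obtain ⟨hNo, hsm, hinj, -, hsymp⟩ := hφ
  obtain ⟨ψ, M, hψ, hMo, hTM, hMN, hEq⟩ := exists_contDiff_eqOn_of_isClosed hNo
    (isClosed_Icc.preimage continuous_norm) hN hsm
  obtain ⟨a, b, ha, haρ, hrb, hab⟩ := exists_setOf_norm_mem_Ioo_subset hMo hρ hρr hTM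
  have hsy : ∀ x : R2n n, ‖x‖ ∈ Ioo a b →
      ∀ v w, sympB n (fderiv ℝ ψ x v) (fderiv ℝ ψ x w) = sympB n v w := fun x hx v w => by
    have hev : ψ =ᶠ[𝓝 x] φ := by
      filter_upwards [hMo.mem_nhds (hab hx)] with y hy using hEq hy
    rw [hev.fderiv_eq, sympB_apply, sympB_apply, ← sympForm_eq_inner, ← sympForm_eq_inner]
    exact hsymp x (hMN (hab hx)) v w
  have hconn : IsConnected {x : R2n n | ‖x‖ ∈ Ioo a b} :=
    isConnected_setOf_norm_mem hn (isConnected_Ioo (haρ.trans_le (hρr.trans hrb.le)))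
      fun t ht => ha.trans_lt ht.1
  have hsign := hconn.2.eq_or_eq_neg_of_sq_eq (f := fun x => (fderiv ℝ ψ x).det)
    (g := fun _ => (1 : ℝ)) (continuous_det_fderiv hψ).continuousOn continuousOn_const
    (fun x hx => by
      simp only [Pi.pow_apply, sq, mul_one]
      exact det_mul_self_eq_one_of_sympB (hsy x hx)) fun _ => one_ne_zero
  have hinjψ : InjOn ψ {x | ‖x‖ ∈ Ioo a b} := fun x hx y hy hxy => by
    rw [hEq (hab hx), hEq (hab hy)] at hxy
    exact hinj (hMN (hab hx)) (hMN (hab hy)) hxy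
  rcases hsign with hs | hs
  · exact ⟨a, b, 1, ψ, ha, haρ, hrb, ⟨hψ, hinjψ, hs, hsy, abs_one⟩, hEq.mono hTM⟩
  · exact ⟨a, b, -1, ψ, ha, haρ, hrb, ⟨hψ, hinjψ, hs, hsy, by simp⟩, hEq.mono hTM⟩

end Extension

/-- If `φ` is a symplectic embedding of a neighbourhood of `r A_δ` into the shell
`U_ε = B_1 \ closure(B_(1-ε))` and the bounded connected component of the complement of
`φ(S_(r(1-δ))^(2n-1))` contains `closure(B_(1-ε))`, then `1 - ε < r(1-δ)` and `r < 1`;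
in particular `δ < ε`. -/
theorem alternative_case_forces_eps_gt_delta
    (n : ℕ) (hn : 2 ≤ n) (δ ε : ℝ) (hδ : δ ∈ Ioo (0 : ℝ) 1) (hε : ε ∈ Ioo (0 : ℝ) 1)
    (r : ℝ) (hr : 0 < r)
    (N : Set (R2n n)) (φ : R2n n → R2n n)
    (hN : closedBall (0 : R2n n) r \ ball 0 (r * (1 - δ)) ⊆ N)
    (hφ : IsSympEmbOn n N (ball (0 : R2n n) 1 \ closedBall 0 (1 - ε)) φ)
    (D : Set (R2n n)) (x : R2n n)
    (hx : x ∈ (φ '' sphere (0 : R2n n) (r * (1 - δ)))ᶜ)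
    (hD : D = connectedComponentIn (φ '' sphere (0 : R2n n) (r * (1 - δ)))ᶜ x)
    (hbd : IsBounded D)
    (hcontain : closedBall (0 : R2n n) (1 - ε) ⊆ D) :
    1 - ε < r * (1 - δ) ∧ r < 1 ∧ δ < ε := by
  have hρ : 0 < r * (1 - δ) := mul_pos hr (by linarith [hδ.2])
  have hρr : r * (1 - δ) < r := by nlinarith [hδ.1]
  have hT : {x : R2n n | ‖x‖ ∈ Icc (r * (1 - δ)) r} ⊆ N := fun x hx =>
    hN ⟨mem_closedBall_zero_iff.2 hx.2, by simpa using hx.1⟩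
  obtain ⟨a, b, s, ψ, ha, haρ, hrb, hψ, hEq⟩ := hφ.exists_isSympShell hn hρ hρr.le hT
  have himg : φ '' sphere (0 : R2n n) (r * (1 - δ)) = ψ '' sphere 0 (r * (1 - δ)) :=
    (EqOn.image_eq (hEq.mono fun x hx => by
      rw [mem_sphere_zero_iff_norm] at hx
      exact ⟨hx.ge, hx.trans_le hρr.le⟩)).symm
  rw [himg] at hD
  obtain ⟨h1, h2⟩ := hψ.radius_bounds hn ha haρ hρr hrb (sub_pos.2 hε.2)
    (fun x hx => by
      rw [hEq hx]
      exact hφ.2.2.2.1 (hT hx)) hD hbd hcontain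
  refine ⟨h1, h2, ?_⟩
  have : r * (1 - δ) < 1 * (1 - δ) := mul_lt_mul_of_pos_right h2 (by linarith [hδ.2])
  linarith
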